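/- Let J denote the Jacobson radical of H_{mn}(ξ). Then: (1) for every (i,j) ∈ I_0 the module Z(λ_{ij}) is a projective H_{mn}(ξ)-module; (2) the Loewy length of H_{mn}(ξ) is 3, i.e. J^3 = 0 and J^2 ≠ 0. -/

import Mathlib

noncomputable section

namespace Radford

variable (𝕜 : Type) [Field 𝕜]

/-- The q-integer `(k)_q = 1 + q + ⋯ + q^(k-1)`. -/
def qInt (q : 𝕜) (k : ℕ) : 𝕜 := ∑ j ∈ Finset.range k, q ^ j

/-- The q-factorial `(k)!_q = (1)_q (2)_q ⋯ (k)_q`. -/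
def qFact (q : 𝕜) : ℕ → 𝕜
  | 0 => 1
  | k + 1 => qFact q k * qInt 𝕜 q (k + 1)

variable (m n : ℕ) (ξ : 𝕜)

/-- Generators of the free algebra: 0 ↦ a, 1 ↦ b, 2 ↦ c, 3 ↦ d. -/
def fgen (k : Fin 4) : FreeAlgebra 𝕜 (Fin 4) := FreeAlgebra.ι 𝕜 k

local notation "fa" => fgen 𝕜 0
local notation "fb" => fgen 𝕜 1
local notation "fc" => fgen 𝕜 2
local notation "fd" => fgen 𝕜 3

/-- The defining relations of the Drinfeld double `H_{mn}(ξ) = D(R_{mn}(q))`, where `q = ξ^m`. -/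
inductive HRel : FreeAlgebra 𝕜 (Fin 4) → FreeAlgebra 𝕜 (Fin 4) → Prop
  | aPow : HRel (fa ^ n) (fb ^ n - 1)
  | bPow : HRel (fb ^ (m * n)) 1
  | cPow : HRel (fc ^ (m * n)) 1
  | dPow : HRel (fd ^ n) 0
  | ab : HRel (fa * fb) (ξ ^ m • (fb * fa))
  | dc : HRel (fd * fc) (ξ • (fc * fd))
  | bc : HRel (fb * fc) (fc * fb)
  | bd : HRel (fb * fd) (ξ ^ m • (fd * fb))
  | ad : HRel (fa * fd - fd * fa) (fb - fc ^ m)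
  | ac : HRel (fa * fc)
      (ξ⁻¹ • (fc * fa) +
        ((ξ⁻¹ - ξ ^ (n - 1)) / qFact 𝕜 (ξ ^ m) (n - 1)) •
          ((fc ^ (m + 1) - ξ ^ m • (fb * fc)) * fd ^ (n - 1)))

/-- The Drinfeld double `H_{mn}(ξ)` of the Radford Hopf algebra `R_{mn}(q)`, presented by
generators `a, b, c, d` and the above relations. -/
def H := RingQuot (HRel 𝕜 m n ξ)

instance : Ring (H 𝕜 m n ξ) := inferInstanceAs (Ring (RingQuot (HRel 𝕜 m n ξ)))

instance : Algebra 𝕜 (H 𝕜 m n ξ) := inferInstanceAs (Algebra 𝕜 (RingQuot (HRel 𝕜 m n ξ)))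

/-- The generators `a, b, c, d` of `H_{mn}(ξ)` (indexed by 0,1,2,3). -/
def gen (k : Fin 4) : H 𝕜 m n ξ := RingQuot.mkAlgHom 𝕜 (HRel 𝕜 m n ξ) (fgen 𝕜 k)

local notation "ha" => gen 𝕜 m n ξ 0
local notation "hb" => gen 𝕜 m n ξ 1
local notation "hc" => gen 𝕜 m n ξ 2
local notation "hd" => gen 𝕜 m n ξ 3

/-- The Jacobson radical `J` of `H_{mn}(ξ)`. -/
def jrad : Ideal (H 𝕜 m n ξ) := Ideal.jacobson ⊥

/-- The scalars `α_k(l,i)`;  `alph l i k` is `α_k(l,i)`, where `q = ξ^m`. -/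
def alph (l : ℕ) (i : ℤ) (k : ℕ) : 𝕜 :=
  if k = n then ((ξ ^ m) ^ (i + (l : ℤ)) - (ξ ^ m) ^ i) / qFact 𝕜 (ξ ^ m) (n - 1)
  else qInt 𝕜 (ξ ^ m) k * ((ξ ^ m) ^ i - (ξ ^ m) ^ (i + (l : ℤ) - (k : ℤ)))

/-- The scalars `γ_k(l,i)`;  `gam l i k` is `γ_k(l,i)`, where `q = ξ^m`. -/
def gam (l : ℕ) (i : ℤ) (k : ℕ) : 𝕜 :=
  if k = n then ((ξ ^ m) ^ i - (ξ ^ m) ^ (i + (l : ℤ))) / qFact 𝕜 (ξ ^ m) (n - 1)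
  else qInt 𝕜 (ξ ^ m) k * ((ξ ^ m) ^ (i + (l : ℤ)) - (ξ ^ m) ^ (i - (k : ℤ)))

section ModuleH

variable {W : Type} [AddCommGroup W] [Module (H 𝕜 m n ξ) W]

variable (W) in
/-- The socle of an `H`-module: the sum of all simple submodules. -/
def socle : Submodule (H 𝕜 m n ξ) W :=
  sSup {N : Submodule (H 𝕜 m n ξ) W | IsSimpleModule (H 𝕜 m n ξ) N}

variable (W) in
/-- The submodule `J•W`, the radical of `W`. -/
def radM : Submodule (H 𝕜 m n ξ) W :=
  Submodule.span (H 𝕜 m n ξ) {x | ∃ r ∈ jrad 𝕜 m n ξ, ∃ w : W, x = r • w}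

variable (W) in
/-- The submodule `J²•W`. -/
def rad2M : Submodule (H 𝕜 m n ξ) W :=
  Submodule.span (H 𝕜 m n ξ)
    {x | ∃ r ∈ jrad 𝕜 m n ξ, ∃ s ∈ jrad 𝕜 m n ξ, ∃ w : W, x = r • s • w}

variable (W) in
/-- The submodule `J³•W`. -/
def rad3M : Submodule (H 𝕜 m n ξ) W :=
  Submodule.span (H 𝕜 m n ξ)
    {x | ∃ r ∈ jrad 𝕜 m n ξ, ∃ s ∈ jrad 𝕜 m n ξ, ∃ t ∈ jrad 𝕜 m n ξ, ∃ w : W, x = r • s • t • w}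

variable (W) in
/-- `lengthIs c W` : the `H`-module `W` has a composition series of length `c`
(hence, by Jordan–Hölder, has composition length `c`). -/
def lengthIs (c : ℕ) : Prop :=
  ∃ s : CompositionSeries (Submodule (H 𝕜 m n ξ) W), s.head = ⊥ ∧ s.last = ⊤ ∧ s.length = c

variable (W) in
/-- An `H`-module is indecomposable if it is nonzero and is not the direct sum of two
nonzero submodules. -/
def Indec : Prop :=
  Nontrivial W ∧ ∀ N₁ N₂ : Submodule (H 𝕜 m n ξ) W, IsCompl N₁ N₂ → N₁ = ⊥ ∨ N₂ = ⊥

variable (W) in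
/-- `W` has Loewy length 2: `J•W ≠ 0` and `J²•W = 0`. -/
def LoewyLen2 : Prop := radM 𝕜 m n ξ W ≠ ⊥ ∧ rad2M 𝕜 m n ξ W = ⊥

variable (W) in
/-- `W` is of `(s,t)`-type: it has Loewy length `2`, its socle has composition length `t`,
and `W/soc W` has composition length `s`. -/
def IsType (s t : ℕ) : Prop :=
  LoewyLen2 𝕜 m n ξ W ∧ lengthIs 𝕜 m n ξ (socle 𝕜 m n ξ W) t ∧
    lengthIs 𝕜 m n ξ (W ⧸ socle 𝕜 m n ξ W) s

end ModuleH

section ModuleK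

variable {V : Type} [AddCommGroup V] [Module 𝕜 V] [Module (H 𝕜 m n ξ) V]
  [IsScalarTower 𝕜 (H 𝕜 m n ξ) V]

variable (V) in
/-- `V^d = {v ∈ V | d•v = 0}`, as a `𝕜`-subspace. -/
def dKer : Submodule 𝕜 V where
  carrier := {v | hd • v = 0}
  add_mem' := by
    intro x y hx hy
    simp only [Set.mem_setOf_eq] at *
    rw [smul_add, hx, hy, add_zero]
  zero_mem' := smul_zero _
  smul_mem' := by
    intro r v hv
    simp only [Set.mem_setOf_eq] at *
    rw [smul_comm, hv, smul_zero]

variable (V) in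
/-- `V_{(i)} = {v ∈ V | c•v = ξ^i v}`, as a `𝕜`-subspace. -/
def eigsp (i : ℤ) : Submodule 𝕜 V where
  carrier := {v | hc • v = ξ ^ i • v}
  add_mem' := by
    intro x y hx hy
    simp only [Set.mem_setOf_eq] at *
    rw [smul_add, hx, hy, smul_add]
  zero_mem' := by simp
  smul_mem' := by
    intro r v hv
    simp only [Set.mem_setOf_eq] at *
    rw [smul_comm, hv, smul_comm]

/-- `V`, equipped with the family `mv : Fin l → V`, realizes the simple module `M(l,i)`:
`mv` is a basis of `V` and the generators act by the defining formulas of `M(l,i)`. -/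
def IsMrep (l : ℕ) (i : ℤ) (mv : Fin l → V) : Prop :=
  LinearIndependent 𝕜 mv ∧ Submodule.span 𝕜 (Set.range mv) = ⊤ ∧
  (∀ (j : ℕ) (hj : j + 1 < l),
    ha • mv ⟨j, by omega⟩ = alph 𝕜 m n ξ l i (j + 1) • mv ⟨j + 1, hj⟩) ∧
  (∀ (j : ℕ) (hj : j < l), j + 1 = l → ha • mv ⟨j, hj⟩ = 0) ∧
  (∀ j : Fin l, hb • mv j = ((ξ ^ m) ^ (i + (l : ℤ) - ((j : ℕ) + 1 : ℤ)) : 𝕜) • mv j) ∧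
  (∀ j : Fin l, hc • mv j = (ξ ^ (i + (j : ℕ) : ℤ) : 𝕜) • mv j) ∧
  (∀ (j : ℕ) (hj : j + 1 < l), hd • mv ⟨j + 1, hj⟩ = mv ⟨j, by omega⟩) ∧
  (∀ hl : 0 < l, hd • mv ⟨0, hl⟩ = 0)

/-- `V` realizes the induced module `Z(λ_{ij})`: there is a cyclic vector `z` with
`d•z = 0`, `b•z = ξ^j z`, `c•z = ξ^i z` such that `(a^k • z)_{0 ≤ k ≤ n-1}` is a basis. -/
def IsZrep (i j : ℤ) (V : Type) [AddCommGroup V] [Module 𝕜 V] [Module (H 𝕜 m n ξ) V]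
    [IsScalarTower 𝕜 (H 𝕜 m n ξ) V] : Prop :=
  ∃ z : V, hd • z = 0 ∧ hb • z = (ξ ^ j : 𝕜) • z ∧ hc • z = (ξ ^ i : 𝕜) • z ∧
    LinearIndependent 𝕜 (fun k : Fin n => (ha ^ (k : ℕ)) • z) ∧
    Submodule.span 𝕜 (Set.range fun k : Fin n => (ha ^ (k : ℕ)) • z) = ⊤

/-- `V`, equipped with the families `v u : Fin n → V`, realizes the projective module `P(l,i)`
with its standard basis. -/
def IsPrep (l : ℕ) (hl1 : 1 ≤ l) (hl2 : l < n) (i : ℤ) (v u : Fin n → V) : Prop :=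
  LinearIndependent 𝕜 (Sum.elim v u) ∧
  Submodule.span 𝕜 (Set.range v ∪ Set.range u) = ⊤ ∧
  (∀ (j : ℕ) (hj : j + l + 2 ≤ n),
    ha • v ⟨j, by omega⟩ = gam 𝕜 m n ξ l i (j + 1) • v ⟨j + 1, by omega⟩) ∧
  (∀ (j : ℕ) (hj : j + 1 < n), n ≤ j + 1 + l →
    ha • v ⟨j, by omega⟩ =
      gam 𝕜 m n ξ l i (j + 1) • v ⟨j + 1, hj⟩ + u ⟨j + 1 + l - n, by omega⟩) ∧
  (ha • v ⟨n - 1, by omega⟩ = gam 𝕜 m n ξ l i n • v ⟨0, by omega⟩ + u ⟨l, by omega⟩) ∧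
  (∀ (j : ℕ) (hj : j + 1 < n),
    ha • u ⟨j, by omega⟩ = alph 𝕜 m n ξ l i (j + 1) • u ⟨j + 1, hj⟩) ∧
  (ha • u ⟨n - 1, by omega⟩ = alph 𝕜 m n ξ l i n • u ⟨0, by omega⟩) ∧
  (∀ j : Fin n, hb • v j = ((ξ ^ m) ^ (i + (n : ℤ) - ((j : ℕ) + 1 : ℤ)) : 𝕜) • v j) ∧
  (∀ j : Fin n, hb • u j = ((ξ ^ m) ^ (i + (l : ℤ) - ((j : ℕ) + 1 : ℤ)) : 𝕜) • u j) ∧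
  (∀ j : Fin n, hc • v j = (ξ ^ (i - ((n : ℤ) - (l : ℤ)) + (j : ℕ) : ℤ) : 𝕜) • v j) ∧
  (∀ j : Fin n, hc • u j = (ξ ^ (i + (j : ℕ) : ℤ) : 𝕜) • u j) ∧
  (hd • v ⟨0, by omega⟩ = 0) ∧
  (∀ (j : ℕ) (hj : j + 1 < n), hd • v ⟨j + 1, hj⟩ = v ⟨j, by omega⟩) ∧
  (hd • u ⟨0, by omega⟩ = 0) ∧
  (∀ (j : ℕ) (hj : j + 1 < n), hd • u ⟨j + 1, hj⟩ = u ⟨j, by omega⟩)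

/-- `V`, equipped with the basis `e : Fin n → V`, realizes the module `T_1(l,i)`. -/
def IsT1rep (l : ℕ) (hl1 : 1 ≤ l) (hl2 : l < n) (i : ℤ) (e : Fin n → V) : Prop :=
  LinearIndependent 𝕜 e ∧ Submodule.span 𝕜 (Set.range e) = ⊤ ∧
  (∀ (j : ℕ) (hj : j + 1 < n),
    ha • e ⟨j, by omega⟩ = alph 𝕜 m n ξ l i (j + 1) • e ⟨j + 1, hj⟩) ∧
  (ha • e ⟨n - 1, by omega⟩ = alph 𝕜 m n ξ l i n • e ⟨0, by omega⟩) ∧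
  (∀ j : Fin n, hb • e j = ((ξ ^ m) ^ (i + (l : ℤ) - ((j : ℕ) + 1 : ℤ)) : 𝕜) • e j) ∧
  (∀ j : Fin n, hc • e j = (ξ ^ (i + (j : ℕ) : ℤ) : 𝕜) • e j) ∧
  (hd • e ⟨0, by omega⟩ = 0) ∧
  (∀ (j : ℕ) (hj : j + 1 < n), hd • e ⟨j + 1, hj⟩ = e ⟨j, by omega⟩)

/-- `V`, equipped with the basis `e : Fin n → V`, realizes the module `T̄_1(l,i)`. -/
def IsT1barrep (l : ℕ) (hl1 : 1 ≤ l) (hl2 : l < n) (i : ℤ) (e : Fin n → V) : Prop :=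
  LinearIndependent 𝕜 e ∧ Submodule.span 𝕜 (Set.range e) = ⊤ ∧
  (∀ (j : ℕ) (hj : j + 1 < n - l),
    ha • e ⟨j, by omega⟩ = alph 𝕜 m n ξ (n - l) (i + l - n) (j + 1) • e ⟨j + 1, by omega⟩) ∧
  (ha • e ⟨n - l - 1, by omega⟩ = e ⟨n - l, by omega⟩) ∧
  (∀ (k : ℕ) (hk : k + 1 < l),
    ha • e ⟨n - l + k, by omega⟩ = alph 𝕜 m n ξ l i (k + 1) • e ⟨n - l + k + 1, by omega⟩) ∧
  (ha • e ⟨n - 1, by omega⟩ = 0) ∧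
  (∀ j : Fin n, hb • e j = ((ξ ^ m) ^ (i - ((j : ℕ) + 1 : ℤ)) : 𝕜) • e j) ∧
  (∀ j : Fin n, hc • e j = (ξ ^ (i + (l : ℤ) - (n : ℤ) + (j : ℕ) : ℤ) : 𝕜) • e j) ∧
  (hd • e ⟨0, by omega⟩ = 0) ∧
  (∀ (j : ℕ) (hj : j + 1 < n - l), hd • e ⟨j + 1, by omega⟩ = e ⟨j, by omega⟩) ∧
  (hd • e ⟨n - l, by omega⟩ = 0) ∧
  (∀ (k : ℕ) (hk : k + 1 < l), hd • e ⟨n - l + k + 1, by omega⟩ = e ⟨n - l + k, by omega⟩)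

end ModuleK

section Matrices

/-- The nilpotent Jordan-type matrix `D_s` with `1` on the superdiagonal. -/
def Dmat (s : ℕ) : Matrix (Fin s) (Fin s) 𝕜 :=
  fun r c => if (r : ℕ) + 1 = (c : ℕ) then 1 else 0

/-- The matrix `X_{l,i}` : subdiagonal entries `γ_k(l,i)`, `(1,n)`-entry `γ_n(l,i)`. -/
def Xmat (l : ℕ) (i : ℤ) : Matrix (Fin n) (Fin n) 𝕜 := fun r c =>
  if (r : ℕ) = (c : ℕ) + 1 then gam 𝕜 m n ξ l i ((c : ℕ) + 1)
  else if (r : ℕ) = 0 ∧ (c : ℕ) = n - 1 then gam 𝕜 m n ξ l i n else 0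

/-- The matrix `Z_{l,i}` : subdiagonal entries `α_k(l,i)`, `(1,n)`-entry `α_n(l,i)`. -/
def Zmat (l : ℕ) (i : ℤ) : Matrix (Fin n) (Fin n) 𝕜 := fun r c =>
  if (r : ℕ) = (c : ℕ) + 1 then alph 𝕜 m n ξ l i ((c : ℕ) + 1)
  else if (r : ℕ) = 0 ∧ (c : ℕ) = n - 1 then alph 𝕜 m n ξ l i n else 0

/-- The block matrix `A(l,i) = [[X_{l,i}, 0], [D_n^{n-l-1}, Z_{l,i}]]`. -/
def Amat (l : ℕ) (i : ℤ) : Matrix (Fin n ⊕ Fin n) (Fin n ⊕ Fin n) 𝕜 :=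
  Matrix.fromBlocks (Xmat 𝕜 m n ξ l i) 0 (Dmat 𝕜 n ^ (n - l - 1)) (Zmat 𝕜 m n ξ l i)

/-- The diagonal matrix `B(l,i)`. -/
def Bmat (l : ℕ) (i : ℤ) : Matrix (Fin n ⊕ Fin n) (Fin n ⊕ Fin n) 𝕜 :=
  Matrix.fromBlocks
    (Matrix.diagonal fun j : Fin n => (ξ ^ m) ^ (i - ((j : ℕ) + 1 : ℤ))) 0 0
    (Matrix.diagonal fun j : Fin n => (ξ ^ m) ^ (i + (l : ℤ) - ((j : ℕ) + 1 : ℤ)))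

/-- The diagonal matrix `C(l,i)`. -/
def Cmat (l : ℕ) (i : ℤ) : Matrix (Fin n ⊕ Fin n) (Fin n ⊕ Fin n) 𝕜 :=
  Matrix.fromBlocks
    (Matrix.diagonal fun j : Fin n => ξ ^ (i + (l : ℤ) - (n : ℤ) + (j : ℕ))) 0 0
    (Matrix.diagonal fun j : Fin n => ξ ^ (i + (j : ℕ) : ℤ))

/-- The block matrix `D = diag(D_n, D_n)`. -/
def Dbig : Matrix (Fin n ⊕ Fin n) (Fin n ⊕ Fin n) 𝕜 :=
  Matrix.fromBlocks (Dmat 𝕜 n) 0 0 (Dmat 𝕜 n)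

end Matrices

section

set_option linter.unusedSectionVars false

variable {𝕜 m n ξ}

/-! ### The defining relations in `H` -/

/-- The quotient map from the free algebra onto `H`. -/
def toH : FreeAlgebra 𝕜 (Fin 4) →ₐ[𝕜] H 𝕜 m n ξ := RingQuot.mkAlgHom 𝕜 (HRel 𝕜 m n ξ)

theorem toH_fgen (k : Fin 4) : toH (fgen 𝕜 k) = gen 𝕜 m n ξ k := rfl

theorem toH_rel {x y : FreeAlgebra 𝕜 (Fin 4)} (h : HRel 𝕜 m n ξ x y) :
    (toH x : H 𝕜 m n ξ) = toH y :=
  RingQuot.mkAlgHom_rel 𝕜 h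

theorem toH_surjective : Function.Surjective (toH : _ → H 𝕜 m n ξ) :=
  RingQuot.mkAlgHom_surjective 𝕜 (HRel 𝕜 m n ξ)

theorem gen_a_pow : ha ^ n = hb ^ n - 1 := by
  simpa only [map_mul, map_smul, map_add, map_sub, map_pow, map_one, map_zero, toH_fgen] using
    toH_rel (HRel.aPow (𝕜 := 𝕜) (m := m) (n := n) (ξ := ξ))

theorem gen_b_pow : hb ^ (m * n) = 1 := by
  simpa only [map_mul, map_smul, map_add, map_sub, map_pow, map_one, map_zero, toH_fgen] using
    toH_rel (HRel.bPow (𝕜 := 𝕜) (m := m) (n := n) (ξ := ξ))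

theorem gen_c_pow : hc ^ (m * n) = 1 := by
  simpa only [map_mul, map_smul, map_add, map_sub, map_pow, map_one, map_zero, toH_fgen] using
    toH_rel (HRel.cPow (𝕜 := 𝕜) (m := m) (n := n) (ξ := ξ))

theorem gen_d_pow : hd ^ n = 0 := by
  simpa only [map_mul, map_smul, map_add, map_sub, map_pow, map_one, map_zero, toH_fgen] using
    toH_rel (HRel.dPow (𝕜 := 𝕜) (m := m) (n := n) (ξ := ξ))

theorem gen_ab : ha * hb = ξ ^ m • (hb * ha) := by
  simpa only [map_mul, map_smul, map_add, map_sub, map_pow, map_one, map_zero, toH_fgen] using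
    toH_rel (HRel.ab (𝕜 := 𝕜) (m := m) (n := n) (ξ := ξ))

theorem gen_dc : hd * hc = ξ • (hc * hd) := by
  simpa only [map_mul, map_smul, map_add, map_sub, map_pow, map_one, map_zero, toH_fgen] using
    toH_rel (HRel.dc (𝕜 := 𝕜) (m := m) (n := n) (ξ := ξ))

theorem gen_bc : hb * hc = hc * hb := by
  simpa only [map_mul, map_smul, map_add, map_sub, map_pow, map_one, map_zero, toH_fgen] using
    toH_rel (HRel.bc (𝕜 := 𝕜) (m := m) (n := n) (ξ := ξ))

theorem gen_bd : hb * hd = ξ ^ m • (hd * hb) := by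
  simpa only [map_mul, map_smul, map_add, map_sub, map_pow, map_one, map_zero, toH_fgen] using
    toH_rel (HRel.bd (𝕜 := 𝕜) (m := m) (n := n) (ξ := ξ))

theorem gen_ad : ha * hd - hd * ha = hb - hc ^ m := by
  simpa only [map_mul, map_smul, map_add, map_sub, map_pow, map_one, map_zero, toH_fgen] using
    toH_rel (HRel.ad (𝕜 := 𝕜) (m := m) (n := n) (ξ := ξ))

theorem gen_da : hd * ha = ha * hd - hb + hc ^ m := by
  have h := gen_ad (𝕜 := 𝕜) (m := m) (n := n) (ξ := ξ)
  rw [sub_eq_iff_eq_add] at h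
  rw [h]; abel

theorem gen_ac : ha * hc = ξ⁻¹ • (hc * ha) +
    ((ξ⁻¹ - ξ ^ (n - 1)) / qFact 𝕜 (ξ ^ m) (n - 1)) •
      ((hc ^ (m + 1) - ξ ^ m • (hb * hc)) * hd ^ (n - 1)) := by
  simpa only [map_mul, map_smul, map_add, map_sub, map_pow, map_one, map_zero, toH_fgen] using
    toH_rel (HRel.ac (𝕜 := 𝕜) (m := m) (n := n) (ξ := ξ))

/-- Induction principle: `H` is generated by the four generators. -/
theorem H_induction {p : H 𝕜 m n ξ → Prop} (h0 : ∀ r : 𝕜, p (algebraMap 𝕜 _ r))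
    (ha' : p ha) (hb' : p hb) (hc' : p hc) (hd' : p hd)
    (hmul : ∀ x y, p x → p y → p (x * y)) (hadd : ∀ x y, p x → p y → p (x + y))
    (x : H 𝕜 m n ξ) : p x := by
  obtain ⟨y, rfl⟩ := toH_surjective x
  induction y using FreeAlgebra.induction with
  | grade0 r => rw [AlgHom.commutes]; exact h0 r
  | grade1 k => fin_cases k <;> assumption
  | mul a b iha ihb => rw [map_mul]; exact hmul _ _ iha ihb
  | add a b iha ihb => rw [map_add]; exact hadd _ _ iha ihb

theorem gen_d_mul_c_pow (k : ℕ) : hd * hc ^ k = ξ ^ k • (hc ^ k * hd) := by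
  induction k with
  | zero => simp
  | succ k ih =>
    rw [pow_succ hc, ← mul_assoc, ih, smul_mul_assoc, mul_assoc, gen_dc, mul_smul_comm, smul_smul,
      ← pow_succ, mul_assoc]

theorem gen_d_pow_mul_c (k : ℕ) : hd ^ k * hc = ξ ^ k • (hc * hd ^ k) := by
  induction k with
  | zero => simp
  | succ k ih =>
    rw [pow_succ hd, mul_assoc, gen_dc, mul_smul_comm, ← mul_assoc, ih, smul_mul_assoc, smul_smul,
      ← pow_succ', mul_assoc]

theorem gen_b_mul_c_pow (k : ℕ) : hb * hc ^ k = hc ^ k * hb := by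
  exact (Commute.pow_right (gen_bc) k)

theorem gen_a_mul_c_pow (k : ℕ) :
    ha * hc ^ k = (ξ⁻¹) ^ k • (hc ^ k * ha) +
    (((ξ⁻¹) ^ k - ξ ^ ((n - 1) * k)) / qFact 𝕜 (ξ ^ m) (n - 1)) •
      ((hc ^ m - ξ ^ m • hb) * hc ^ k * hd ^ (n - 1)) := by
  induction k with
  | zero => simp
  | succ k ih =>
    have e1 : ∀ x : H 𝕜 m n ξ, (hc ^ m - ξ ^ m • hb) * hc ^ k * x =
        hc ^ k * ((hc ^ m - ξ ^ m • hb) * x) := by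
      intro x
      have : (hc ^ m - ξ ^ m • hb) * hc ^ k = hc ^ k * (hc ^ m - ξ ^ m • hb) := by
        rw [sub_mul, mul_sub, ← pow_add, ← pow_add, add_comm, smul_mul_assoc, mul_smul_comm,
          gen_b_mul_c_pow]
      rw [this, mul_assoc]
    have e2 : (hc ^ m - ξ ^ m • hb) * hc ^ (k + 1) * hd ^ (n - 1) =
        hc ^ k * ((hc ^ m - ξ ^ m • hb) * (hc * hd ^ (n - 1))) := by
      rw [pow_succ, ← e1]; simp only [mul_assoc]
    have e3 : (hc ^ (m + 1) - ξ ^ m • (hb * hc)) * hd ^ (n - 1) =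
        (hc ^ m - ξ ^ m • hb) * (hc * hd ^ (n - 1)) := by
      rw [pow_succ, ← smul_mul_assoc, ← sub_mul, mul_assoc]
    rw [e2, pow_succ hc, ← mul_assoc, ih, add_mul, smul_mul_assoc, mul_assoc (hc ^ k), gen_ac, e3,
      smul_mul_assoc, mul_assoc _ _ hc, gen_d_pow_mul_c, mul_smul_comm, e1, mul_add, smul_add,
      mul_smul_comm, mul_smul_comm, mul_assoc]
    have e4 : ξ ^ ((n - 1) * (k + 1)) = ξ ^ ((n - 1) * k) * ξ ^ (n - 1) := by
      rw [← pow_add]; congr 1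
    rw [e4]
    module

theorem gen_c_pow_m_mul_a (hm : 1 < m) (hn : 1 < n) (hξ : IsPrimitiveRoot ξ (m * n)) :
    hc ^ m * ha = ξ ^ m • (ha * hc ^ m) := by
  have hξ0 : ξ ≠ 0 := hξ.ne_zero (by positivity)
  have h := gen_a_mul_c_pow (𝕜 := 𝕜) (m := m) (n := n) (ξ := ξ) m
  have h1 : (ξ⁻¹) ^ m - ξ ^ ((n - 1) * m) = 0 := by
    have : ξ ^ ((n - 1) * m) * ξ ^ m = 1 := by
      rw [← pow_add, ← hξ.pow_eq_one]
      congr 1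
      obtain ⟨n, rfl⟩ : ∃ k, n = k + 1 := ⟨n - 1, by omega⟩
      simp; ring
    rw [inv_pow, sub_eq_zero, eq_comm, ← mul_left_inj' (pow_ne_zero m hξ0), this,
      inv_mul_cancel₀ (pow_ne_zero m hξ0)]
  rw [h1, zero_div, zero_smul, add_zero] at h
  rw [h, smul_smul, ← mul_pow, mul_inv_cancel₀ hξ0, one_pow, one_smul]

theorem gen_b_mul_a (hξ0 : ξ ≠ 0) : hb * ha = (ξ ^ m)⁻¹ • (ha * hb) := by
  rw [gen_ab, smul_smul, inv_mul_cancel₀ (pow_ne_zero _ hξ0), one_smul]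

theorem gen_c_pow_m_mul_d (hξ0 : ξ ≠ 0) : hc ^ m * hd = (ξ ^ m)⁻¹ • (hd * hc ^ m) := by
  rw [gen_d_mul_c_pow, smul_smul, inv_mul_cancel₀ (pow_ne_zero _ hξ0), one_smul]

theorem gen_d_mul_a_pow (hm : 1 < m) (hn : 1 < n) (hξ : IsPrimitiveRoot ξ (m * n)) (k : ℕ) :
    hd * ha ^ (k + 1) = ha ^ (k + 1) * hd +
      qInt 𝕜 (ξ ^ m) (k + 1) • (ha ^ k * (hc ^ m - ((ξ ^ m)⁻¹) ^ k • hb)) := by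
  have hξ0 : ξ ≠ 0 := hξ.ne_zero (by positivity)
  induction k with
  | zero => simp [qInt, gen_da]; abel
  | succ k ih =>
    have hq : ξ ^ m ≠ 0 := pow_ne_zero _ hξ0
    have e : qInt 𝕜 (ξ ^ m) (k + 1 + 1) = ξ ^ m * qInt 𝕜 (ξ ^ m) (k + 1) + 1 := by
      simp only [qInt]
      rw [Finset.sum_range_succ', Finset.mul_sum]; simp [pow_succ']
    have e' : qInt 𝕜 (ξ ^ m) (k + 1 + 1) = qInt 𝕜 (ξ ^ m) (k + 1) + (ξ ^ m) ^ (k + 1) := by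
      simp only [qInt]
      rw [Finset.sum_range_succ]
    rw [pow_succ ha (k + 1), ← mul_assoc, ih, add_mul, mul_assoc _ hd, gen_da, smul_mul_assoc,
      mul_assoc (ha ^ k), sub_mul, smul_mul_assoc, gen_b_mul_a hξ0, gen_c_pow_m_mul_a hm hn hξ]
    simp only [mul_add, mul_sub, mul_smul_comm, smul_sub, smul_smul, ← mul_assoc, ← pow_succ]
    have e2 : qInt 𝕜 (ξ ^ m) (k + 1 + 1) * (ξ ^ m)⁻¹ ^ (k + 1) =
      qInt 𝕜 (ξ ^ m) (k + 1) * (ξ ^ m)⁻¹ ^ (k + 1) + 1 := by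
      rw [e', add_mul, ← mul_pow, mul_inv_cancel₀ hq, one_pow]
    have e3 : qInt 𝕜 (ξ ^ m) (k + 1) * ((ξ ^ m)⁻¹ ^ k * (ξ ^ m)⁻¹) =
      qInt 𝕜 (ξ ^ m) (k + 1) * (ξ ^ m)⁻¹ ^ (k + 1) := by rw [← pow_succ]
    rw [e2, e]
    module

/-! ### Weight vectors and the Casimir element -/

theorem isPrimitiveRoot_q (hm : 1 < m) (hn : 1 < n) (hξ : IsPrimitiveRoot ξ (m * n)) :
    IsPrimitiveRoot (ξ ^ m) n :=
  hξ.pow (by positivity) rfl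

theorem one_sub_q_ne_zero (hm : 1 < m) (hn : 1 < n) (hξ : IsPrimitiveRoot ξ (m * n)) :
    1 - ξ ^ m ≠ 0 :=
  sub_ne_zero.mpr ((isPrimitiveRoot_q hm hn hξ).ne_one hn).symm

theorem qInt_ne_zero {q : 𝕜} (hq : IsPrimitiveRoot q n) {k : ℕ} (hk : 0 < k) (hkn : k < n) :
    qInt 𝕜 q k ≠ 0 := by
  intro h
  have := mul_geom_sum q k
  rw [qInt] at h
  rw [h, mul_zero, eq_comm, sub_eq_zero] at this
  exact hq.pow_ne_one_of_pos_of_lt hk.ne' hkn this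

section Weights

variable {W : Type*} [AddCommGroup W] [Module 𝕜 W] [Module (H 𝕜 m n ξ) W]
  [IsScalarTower 𝕜 (H 𝕜 m n ξ) W]

variable (m n ξ) in
/-- `x` is a vector on which `b` acts by `μ` and `c ^ m` acts by `ν`. -/
structure IsWt (μ ν : 𝕜) (x : W) : Prop where
  b : hb • x = μ • x
  c : hc ^ m • x = ν • x

theorem gen_b_smul_a_smul (hξ0 : ξ ≠ 0) (x : W) : hb • ha • x = (ξ ^ m)⁻¹ • ha • hb • x := by
  rw [← mul_smul, gen_b_mul_a hξ0, smul_assoc, mul_smul]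

theorem gen_b_smul_d_smul (x : W) : hb • hd • x = (ξ ^ m) • hd • hb • x := by
  rw [← mul_smul, gen_bd, smul_assoc, mul_smul]

theorem gen_d_smul_c_smul (x : W) : hd • hc • x = ξ • hc • hd • x := by
  rw [← mul_smul, gen_dc, smul_assoc, mul_smul]

theorem gen_b_smul_c_smul (x : W) : hb • hc • x = hc • hb • x := by
  rw [← mul_smul, gen_bc, mul_smul]

theorem gen_d_smul_a_smul (x : W) : hd • ha • x = ha • hd • x - hb • x + hc ^ m • x := by
  rw [← mul_smul, gen_da, add_smul, sub_smul, mul_smul]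

theorem IsWt.a_smul (hm : 1 < m) (hn : 1 < n) (hξ : IsPrimitiveRoot ξ (m * n)) {μ ν : 𝕜} {x : W}
    (h : IsWt m n ξ μ ν x) : IsWt m n ξ ((ξ ^ m)⁻¹ * μ) (ξ ^ m * ν) (ha • x) := by
  have hξ0 : ξ ≠ 0 := hξ.ne_zero (by positivity)
  constructor
  · rw [gen_b_smul_a_smul hξ0, h.b, smul_comm _ μ, mul_smul]
  · rw [← mul_smul, gen_c_pow_m_mul_a hm hn hξ, smul_assoc, mul_smul, h.c, smul_comm _ ν, mul_smul]

theorem IsWt.d_smul (hξ0 : ξ ≠ 0) {μ ν : 𝕜} {x : W} (h : IsWt m n ξ μ ν x) :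
    IsWt m n ξ (ξ ^ m * μ) ((ξ ^ m)⁻¹ * ν) (hd • x) := by
  constructor
  · rw [gen_b_smul_d_smul, h.b, smul_comm _ μ, mul_smul]
  · rw [← mul_smul, gen_c_pow_m_mul_d hξ0, smul_assoc, mul_smul, h.c, smul_comm _ ν, mul_smul]

theorem IsWt.c_smul {μ ν : 𝕜} {x : W} (h : IsWt m n ξ μ ν x) : IsWt m n ξ μ ν (hc • x) := by
  constructor
  · rw [gen_b_smul_c_smul, h.b, smul_comm]
  · rw [← mul_smul, ← pow_succ, pow_succ', mul_smul, h.c, smul_comm]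

theorem IsWt.a_pow_smul (hm : 1 < m) (hn : 1 < n) (hξ : IsPrimitiveRoot ξ (m * n)) {μ ν : 𝕜}
    {x : W} (h : IsWt m n ξ μ ν x) (k : ℕ) :
    IsWt m n ξ (((ξ ^ m)⁻¹) ^ k * μ) ((ξ ^ m) ^ k * ν) (ha ^ k • x) := by
  induction k with
  | zero => simpa using h
  | succ k ih =>
    have := ih.a_smul hm hn hξ
    rwa [← mul_assoc, ← pow_succ', ← mul_assoc, ← pow_succ', ← mul_smul, ← pow_succ'] at this

theorem IsWt.d_pow_smul (hξ0 : ξ ≠ 0) {μ ν : 𝕜} {x : W} (h : IsWt m n ξ μ ν x) (k : ℕ) :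
    IsWt m n ξ ((ξ ^ m) ^ k * μ) (((ξ ^ m)⁻¹) ^ k * ν) (hd ^ k • x) := by
  induction k with
  | zero => simpa using h
  | succ k ih =>
    have := ih.d_smul hξ0
    rwa [← mul_assoc, ← pow_succ', ← mul_assoc, ← pow_succ', ← mul_smul, ← pow_succ'] at this

theorem IsWt.c_pow_smul {μ ν : 𝕜} {x : W} (h : IsWt m n ξ μ ν x) (k : ℕ) :
    IsWt m n ξ μ ν (hc ^ k • x) := by
  induction k with
  | zero => simpa using h
  | succ k ih =>
    have := ih.c_smul
    rwa [← mul_smul, ← pow_succ'] at this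

theorem IsWt.b_pow_smul {μ ν : 𝕜} {x : W} (h : IsWt m n ξ μ ν x) (k : ℕ) :
    hb ^ k • x = μ ^ k • x := by
  induction k with
  | zero => simp
  | succ k ih => rw [pow_succ, mul_smul, h.b, smul_comm, ih, smul_smul, pow_succ']

theorem IsWt.a_pow_n_smul {μ ν : 𝕜} {x : W} (h : IsWt m n ξ μ ν x) :
    ha ^ n • x = (μ ^ n - 1) • x := by
  rw [gen_a_pow, sub_smul, one_smul, h.b_pow_smul, sub_smul, one_smul]

theorem IsWt.d_smul_a_pow_smul (hm : 1 < m) (hn : 1 < n) (hξ : IsPrimitiveRoot ξ (m * n))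
    {μ ν : 𝕜} {x : W} (h : IsWt m n ξ μ ν x) (k : ℕ) :
    hd • ha ^ (k + 1) • x = ha ^ (k + 1) • hd • x +
      (qInt 𝕜 (ξ ^ m) (k + 1) * (ν - ((ξ ^ m)⁻¹) ^ k * μ)) • ha ^ k • x := by
  rw [← mul_smul, gen_d_mul_a_pow hm hn hξ, add_smul, mul_smul, smul_assoc, mul_smul, sub_smul,
    smul_assoc, h.b, h.c, smul_smul ((ξ ^ m)⁻¹ ^ k) μ, ← sub_smul, smul_comm (ha ^ k),
    mul_smul (qInt 𝕜 (ξ ^ m) (k + 1))]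

variable (𝕜 m n ξ) in
/-- The Casimir element of `H`. -/
def cas : H 𝕜 m n ξ := (1 - ξ ^ m) • (ha * hd) + ξ ^ m • hb + hc ^ m

theorem cas_mul (hm : 1 < m) (hn : 1 < n) (hξ : IsPrimitiveRoot ξ (m * n)) (x : H 𝕜 m n ξ) :
    cas 𝕜 m n ξ * x = x * cas 𝕜 m n ξ := by
  have hξ0 : ξ ≠ 0 := hξ.ne_zero (by positivity)
  have hq : ξ ^ m ≠ 0 := pow_ne_zero _ hξ0
  induction x using H_induction with
  | h0 r => exact (Algebra.commutes _ _).symm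
  | ha' =>
    simp only [cas, add_mul, mul_add, smul_mul_assoc, mul_smul_comm, gen_c_pow_m_mul_a hm hn hξ,
      gen_b_mul_a hξ0, mul_assoc ha hd ha, gen_da, mul_sub, smul_add, smul_sub, smul_smul,
      mul_inv_cancel₀ hq]
    module
  | hb' =>
    have h1 : hd * hb = (ξ ^ m)⁻¹ • (hb * hd) := by
      rw [gen_bd, smul_smul, inv_mul_cancel₀ hq, one_smul]
    have h2 : hc ^ m * hb = hb * hc ^ m := (gen_b_mul_c_pow m).symm
    simp only [cas, add_mul, mul_add, smul_mul_assoc, mul_smul_comm, mul_assoc, h1, h2]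
    rw [← mul_assoc ha, gen_ab, smul_mul_assoc, smul_smul (ξ ^ m)⁻¹, inv_mul_cancel₀ hq, one_smul,
      mul_assoc]
  | hc' =>
    have h1 : ha * hd * hc = hc * (ha * hd) := by
      rw [mul_assoc, gen_dc, mul_smul_comm, ← mul_assoc, gen_ac, add_mul, smul_add, smul_mul_assoc,
        smul_smul, mul_inv_cancel₀ hξ0, one_smul, smul_mul_assoc,
        mul_assoc (hc ^ (m + 1) - _) (hd ^ (n - 1)) hd, mul_assoc hc ha hd, ← pow_succ hd,
        Nat.sub_add_cancel hn.le, gen_d_pow, mul_zero, smul_zero, smul_zero, add_zero]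
    rw [cas, add_mul, add_mul, smul_mul_assoc, smul_mul_assoc, h1, gen_bc, ← pow_succ, pow_succ',
      mul_add, mul_add, mul_smul_comm, mul_smul_comm]
  | hd' =>
    have h1 : hd * hb = (ξ ^ m)⁻¹ • (hb * hd) := by
      rw [gen_bd, smul_smul, inv_mul_cancel₀ hq, one_smul]
    simp only [cas, add_mul, mul_add, smul_mul_assoc, mul_smul_comm, ← mul_assoc, gen_da,
      gen_d_mul_c_pow, sub_mul, h1, smul_add, smul_sub, smul_smul, mul_inv_cancel₀ hq]
    module
  | hmul x y hx hy => rw [← mul_assoc, hx, mul_assoc, hy, mul_assoc]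
  | hadd x y hx hy => rw [mul_add, add_mul, hx, hy]

theorem cas_smul_smul (hm : 1 < m) (hn : 1 < n) (hξ : IsPrimitiveRoot ξ (m * n))
    (h : H 𝕜 m n ξ) (x : W) : cas 𝕜 m n ξ • h • x = h • cas 𝕜 m n ξ • x := by
  rw [← mul_smul, cas_mul hm hn hξ, mul_smul]

theorem IsWt.cas_smul {μ ν : 𝕜} {x : W} (h : IsWt m n ξ μ ν x) :
    cas 𝕜 m n ξ • x = (1 - ξ ^ m) • ha • hd • x + (ξ ^ m * μ + ν) • x := by
  rw [cas, add_smul, add_smul, smul_assoc, smul_assoc, h.b, h.c, mul_smul ha hd x, add_smul,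
    smul_smul (ξ ^ m) μ, add_assoc]

variable (m n ξ) in
/-- `x` is a generalized eigenvector of the Casimir element for `γ`. -/
def IsGen (γ : 𝕜) (x : W) : Prop :=
  ∃ k : ℕ, (cas 𝕜 m n ξ - algebraMap 𝕜 _ γ) ^ k • x = 0

theorem IsGen.smul (hm : 1 < m) (hn : 1 < n) (hξ : IsPrimitiveRoot ξ (m * n)) {γ : 𝕜} {x : W}
    (h : IsGen m n ξ γ x) (y : H 𝕜 m n ξ) : IsGen m n ξ γ (y • x) := by
  obtain ⟨k, hk⟩ := h
  refine ⟨k, ?_⟩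
  have : Commute ((cas 𝕜 m n ξ - algebraMap 𝕜 _ γ) ^ k) y :=
    Commute.pow_left (Commute.sub_left (cas_mul hm hn hξ y) (Algebra.commutes _ _)) k
  rw [← mul_smul, this.eq, mul_smul, hk, smul_zero]

theorem IsGen.mem_of_cas_smul_sub_mem (hm : 1 < m) (hn : 1 < n) (hξ : IsPrimitiveRoot ξ (m * n))
    (N : Submodule (H 𝕜 m n ξ) W) {γ δ : 𝕜} (hγ : δ ≠ γ) {x : W} (h : IsGen m n ξ γ x)
    (hx : cas 𝕜 m n ξ • x - δ • x ∈ N) : x ∈ N := by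
  obtain ⟨k, hk⟩ := h
  induction k generalizing x with
  | zero => simp only [pow_zero, one_smul] at hk; rw [hk]; exact N.zero_mem
  | succ k ih =>
    have h1 : (cas 𝕜 m n ξ - algebraMap 𝕜 _ γ) • x ∈ N := by
      apply ih
      · rw [cas_smul_smul hm hn hξ, smul_comm δ, ← smul_sub]
        exact N.smul_mem _ hx
      · rw [← mul_smul, ← pow_succ, hk]
    rw [sub_smul, algebraMap_smul] at h1
    have h2 := N.sub_mem h1 hx
    have h3 : cas 𝕜 m n ξ • x - γ • x - (cas 𝕜 m n ξ • x - δ • x) = (δ - γ) • x := by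
      rw [sub_smul]; abel
    rw [h3] at h2
    have h4 := N.smul_of_tower_mem (δ - γ)⁻¹ h2
    rwa [smul_smul, inv_mul_cancel₀ (sub_ne_zero.mpr hγ), one_smul] at h4

theorem IsWt.mem_of_a_d_mem (hm : 1 < m) (hn : 1 < n) (hξ : IsPrimitiveRoot ξ (m * n))
    (N : Submodule (H 𝕜 m n ξ) W) {γ μ ν : 𝕜} (hγ : ξ ^ m * μ + ν ≠ γ) {x : W}
    (h : IsGen m n ξ γ x) (hw : IsWt m n ξ μ ν x) (hx : ha • hd • x ∈ N) : x ∈ N := by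
  refine h.mem_of_cas_smul_sub_mem hm hn hξ N hγ ?_
  rw [hw.cas_smul, add_sub_cancel_right]
  exact N.smul_of_tower_mem _ hx

end Weights

/-! ### Spectral projections of an element of finite order -/

section SpecProj

variable {R : Type*} [Ring R] [Algebra 𝕜 R]

/-- For `t ^ N = 1` and `ζ ^ N = 1`, the projection onto the `ζ`-eigenspace of `t`. -/
def specProj (N : ℕ) (ζ : 𝕜) (t : R) : R :=
  (N : 𝕜)⁻¹ • ∑ k ∈ Finset.range N, ζ⁻¹ ^ k • t ^ k

theorem mul_specProj {N : ℕ} {ζ : 𝕜} {t : R} (hζ0 : ζ ≠ 0) (hζ : ζ ^ N = 1) (ht : t ^ N = 1) :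
    t * specProj N ζ t = ζ • specProj N ζ t := by
  have h1 : ∀ k, t * (ζ⁻¹ ^ k • t ^ k) = ζ • (ζ⁻¹ ^ (k + 1) • t ^ (k + 1)) := fun k => by
    rw [mul_smul_comm, smul_smul, pow_succ' ζ⁻¹, ← mul_assoc, mul_inv_cancel₀ hζ0, one_mul,
      pow_succ' t]
  have h2 := Finset.sum_range_succ (fun k => ζ⁻¹ ^ k • t ^ k) N
  rw [Finset.sum_range_succ', inv_pow ζ N, hζ, ht, pow_zero, pow_zero, inv_one, add_left_inj] at h2
  rw [specProj, mul_smul_comm, Finset.mul_sum, Finset.sum_congr rfl fun k _ => h1 k,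
    ← Finset.smul_sum, h2, smul_comm]

theorem sum_specProj {N : ℕ} [NeZero N] {ξ : 𝕜} (hξ : IsPrimitiveRoot ξ N) (t : R) :
    ∑ j ∈ Finset.range N, specProj N (ξ ^ j) t = 1 := by
  have hN : (N : 𝕜) ≠ 0 := hξ.neZero'.out
  have h1 : ∀ k ∈ Finset.range N, ∑ j ∈ Finset.range N, (ξ ^ j)⁻¹ ^ k • t ^ k =
      if k = 0 then (N : 𝕜) • (1 : R) else 0 := by
    intro k hk
    rw [← Finset.sum_smul]
    split_ifs with h0
    · subst h0; simp
    · have h2 : ∀ j, (ξ ^ j)⁻¹ ^ k = (ξ⁻¹ ^ k) ^ j := fun j => by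
        rw [← inv_pow, ← pow_mul, ← pow_mul, mul_comm]
      simp only [h2]
      have h3 := mul_geom_sum (ξ⁻¹ ^ k) N
      rw [← pow_mul, mul_comm k, pow_mul, inv_pow ξ N, hξ.pow_eq_one, inv_one, one_pow,
        sub_self] at h3
      rcases mul_eq_zero.mp h3 with h4 | h4
      · exact absurd (sub_eq_zero.mp h4)
          (hξ.inv.pow_ne_one_of_pos_of_lt h0 (Finset.mem_range.mp hk))
      · rw [h4, zero_smul]
  simp only [specProj]
  rw [← Finset.smul_sum, Finset.sum_comm, Finset.sum_congr rfl h1, Finset.sum_ite_eq',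
    if_pos (Finset.mem_range.mpr (NeZero.pos N)), smul_smul, inv_mul_cancel₀ hN, one_smul]

theorem specProj_smul {W : Type*} [AddCommGroup W] [Module 𝕜 W] [Module R W] [IsScalarTower 𝕜 R W]
    {N : ℕ} (hN : (N : 𝕜) ≠ 0) {ζ : 𝕜} (hζ0 : ζ ≠ 0) {t : R} {x : W} (hx : t • x = ζ • x) :
    specProj N ζ t • x = x := by
  have h1 : ∀ k, t ^ k • x = ζ ^ k • x := fun k => by
    induction k with
    | zero => simp
    | succ k ih => rw [pow_succ, mul_smul, hx, smul_comm, ih, smul_smul, pow_succ']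
  have h2 : ∀ k, (ζ⁻¹ ^ k • t ^ k) • x = x := fun k => by
    rw [smul_assoc, h1, smul_smul, ← mul_pow, inv_mul_cancel₀ hζ0, one_pow, one_smul]
  rw [specProj, smul_assoc, Finset.sum_smul, Finset.sum_congr rfl fun k _ => h2 k,
    Finset.sum_const, Finset.card_range, ← Nat.cast_smul_eq_nsmul 𝕜, smul_smul,
    inv_mul_cancel₀ hN, one_smul]

theorem smul_specProj_smul {W : Type*} [AddCommGroup W] [Module 𝕜 W] [Module R W]
    [IsScalarTower 𝕜 R W] (N : ℕ) (ζ : 𝕜) {g t : R} {r : 𝕜} {x : W}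
    (hx : ∀ k, g • t ^ k • x = r • t ^ k • x) :
    g • specProj N ζ t • x = r • specProj N ζ t • x := by
  simp only [specProj, smul_assoc, Finset.sum_smul, Finset.smul_sum]
  refine Finset.sum_congr rfl fun k _ => ?_
  rw [smul_comm g, smul_comm g, hx, smul_comm r (N : 𝕜)⁻¹, smul_comm r (ζ⁻¹ ^ k)]

theorem smul_specProj_pow_smul {W : Type*} [AddCommGroup W] [Module 𝕜 W] [Module R W]
    [IsScalarTower 𝕜 R W] {N : ℕ} {ξ : 𝕜} (hξ0 : ξ ≠ 0) (hξ : ξ ^ N = 1) {t : R} (ht : t ^ N = 1)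
    (j : ℕ) (x : W) :
    t • specProj N (ξ ^ j) t • x = ξ ^ j • specProj N (ξ ^ j) t • x := by
  rw [← mul_smul, mul_specProj (pow_ne_zero _ hξ0) _ ht, smul_assoc]
  rw [← pow_mul, mul_comm, pow_mul, hξ, one_pow]

end SpecProj

/-! ### Cyclic modules generated by vectors killed by `d` -/

section HighestWeight

variable {W : Type*} [AddCommGroup W] [Module 𝕜 W] [Module (H 𝕜 m n ξ) W]
  [IsScalarTower 𝕜 (H 𝕜 m n ξ) W]

theorem gen_d_smul_c_pow_smul_eq_zero {x : W} (hx : hd • x = 0) (k : ℕ) :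
    hd • hc ^ k • x = 0 := by
  rw [← mul_smul, gen_d_mul_c_pow, smul_assoc, mul_smul, hx, smul_zero, smul_zero]

theorem gen_d_pow_smul_a_pow_smul_eq_zero (hm : 1 < m) (hn : 1 < n)
    (hξ : IsPrimitiveRoot ξ (m * n)) {μ ν : 𝕜} {x : W} (h : IsWt m n ξ μ ν x) (hx : hd • x = 0)
    {j k : ℕ} (hjk : k < j) : hd ^ j • ha ^ k • x = 0 := by
  induction k generalizing j with
  | zero =>
    obtain ⟨j, rfl⟩ := Nat.exists_eq_succ_of_ne_zero (by omega : j ≠ 0)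
    rw [pow_zero, one_smul, pow_succ, mul_smul, hx, smul_zero]
  | succ k ih =>
    obtain ⟨j, rfl⟩ := Nat.exists_eq_succ_of_ne_zero (by omega : j ≠ 0)
    rw [pow_succ hd, mul_smul, h.d_smul_a_pow_smul hm hn hξ, hx, smul_zero, zero_add, smul_comm,
      ih (by omega), smul_zero]

theorem gen_d_pow_smul_a_pow_smul (hm : 1 < m) (hn : 1 < n)
    (hξ : IsPrimitiveRoot ξ (m * n)) {μ ν : 𝕜} {x : W} (h : IsWt m n ξ μ ν x) (hx : hd • x = 0)
    (k : ℕ) : hd ^ k • ha ^ k • x =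
      (∏ i ∈ Finset.range k, qInt 𝕜 (ξ ^ m) (i + 1) * (ν - ((ξ ^ m)⁻¹) ^ i * μ)) • x := by
  induction k with
  | zero => simp
  | succ k ih =>
    rw [pow_succ hd, mul_smul, h.d_smul_a_pow_smul hm hn hξ, hx, smul_zero, zero_add, smul_comm,
      ih, smul_smul, Finset.prod_range_succ, mul_comm]

theorem gen_a_smul_c_smul {x : W} (hx : hd ^ (n - 1) • x = 0) :
    ha • hc • x = ξ⁻¹ • hc • ha • x := by
  rw [← mul_smul, gen_ac, add_smul, smul_assoc, smul_assoc, mul_smul _ (hd ^ (n - 1)), hx,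
    smul_zero, smul_zero, add_zero, mul_smul]

theorem gen_a_pow_smul_c_smul (hm : 1 < m) (hn : 1 < n)
    (hξ : IsPrimitiveRoot ξ (m * n)) {μ ν : 𝕜} {x : W} (h : IsWt m n ξ μ ν x) (hx : hd • x = 0)
    {l : ℕ} (hl : l < n) : ha ^ l • hc • x = ξ⁻¹ ^ l • hc • ha ^ l • x := by
  induction l with
  | zero => simp
  | succ l ih =>
    have h0 := gen_d_pow_smul_a_pow_smul_eq_zero hm hn hξ h hx (show l < n - 1 by omega)
    rw [pow_succ' ha, mul_smul, ih (by omega), smul_comm ha, gen_a_smul_c_smul h0, smul_smul,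
      ← pow_succ, mul_smul]

theorem gen_c_smul_a_pow_smul (hm : 1 < m) (hn : 1 < n)
    (hξ : IsPrimitiveRoot ξ (m * n)) {μ ν : 𝕜} {x : W} (h : IsWt m n ξ μ ν x) (hx : hd • x = 0)
    {l : ℕ} (hl : l < n) : hc • ha ^ l • x = ξ ^ l • ha ^ l • hc • x := by
  rw [gen_a_pow_smul_c_smul hm hn hξ h hx hl, smul_smul (ξ ^ l), ← mul_pow,
    mul_inv_cancel₀ (hξ.ne_zero (by positivity)), one_pow, one_smul]

theorem isWt_of_c_smul {μ χ : 𝕜} {x : W} (hb' : hb • x = μ • x) (hc' : hc • x = χ • x) :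
    IsWt m n ξ μ (χ ^ m) x := by
  refine ⟨hb', ?_⟩
  have : ∀ k, hc ^ k • x = χ ^ k • x := fun k => by
    induction k with
    | zero => simp
    | succ k ih => rw [pow_succ, mul_smul, hc', smul_comm, ih, smul_smul, pow_succ']
  exact this m

/-- A cyclic module generated by a simultaneous eigenvector `x` of `b` and `c` killed by `d` is
spanned by the vectors `a ^ k • x`, `k < n`. -/
theorem exists_smul_eq_sum (hm : 1 < m) (hn : 1 < n)
    (hξ : IsPrimitiveRoot ξ (m * n)) {μ χ : 𝕜} {x : W} (hb' : hb • x = μ • x)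
    (hc' : hc • x = χ • x) (hx : hd • x = 0) (y : H 𝕜 m n ξ) :
    ∃ f : Fin n → 𝕜, ∑ k, f k • ha ^ (k : ℕ) • x = y • x := by
  have h := isWt_of_c_smul hb' hc'
  rw [← Submodule.mem_span_range_iff_exists_fun 𝕜]
  set T := Submodule.span 𝕜 (Set.range fun k : Fin n => ha ^ (k : ℕ) • x) with hT
  have hmem : ∀ k, k < n → ha ^ k • x ∈ T := fun k hk =>
    Submodule.subset_span ⟨⟨k, hk⟩, rfl⟩
  have hgen : ∀ g : H 𝕜 m n ξ, (∀ k, k < n → g • ha ^ k • x ∈ T) → ∀ t ∈ T, g • t ∈ T := by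
    intro g hg t ht
    induction ht using Submodule.span_induction with
    | mem t ht => obtain ⟨k, rfl⟩ := ht; exact hg k k.2
    | zero => rw [smul_zero]; exact T.zero_mem
    | add u v _ _ hu hv => rw [smul_add]; exact T.add_mem hu hv
    | smul r u _ hu => rw [smul_comm]; exact T.smul_mem r hu
  suffices H0 : ∀ t ∈ T, y • t ∈ T by
    have := H0 _ (hmem 0 (by omega))
    rwa [pow_zero, one_smul] at this
  induction y using H_induction with
  | h0 r => intro t ht; rw [algebraMap_smul]; exact T.smul_mem r ht
  | ha' =>
    refine hgen _ fun k hk => ?_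
    rw [← mul_smul, ← pow_succ']
    rcases (show k + 1 < n ∨ k + 1 = n by omega) with hk' | hk'
    · exact hmem _ hk'
    · rw [hk', h.a_pow_n_smul]
      simpa using T.smul_mem (μ ^ n - 1) (hmem 0 (by omega))
  | hb' =>
    refine hgen _ fun k hk => ?_
    rw [(h.a_pow_smul hm hn hξ k).b]
    exact T.smul_mem _ (hmem k hk)
  | hc' =>
    refine hgen _ fun k hk => ?_
    rw [gen_c_smul_a_pow_smul hm hn hξ h hx hk, hc', smul_comm (ha ^ k)]
    exact T.smul_mem _ (T.smul_mem _ (hmem k hk))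
  | hd' =>
    refine hgen _ fun k hk => ?_
    cases k with
    | zero => rw [pow_zero, one_smul, hx]; exact T.zero_mem
    | succ k =>
      rw [h.d_smul_a_pow_smul hm hn hξ, hx, smul_zero, zero_add]
      exact T.smul_mem _ (hmem k (by omega))
  | hmul u v hu hv => intro t ht; rw [mul_smul]; exact hu _ (hv _ ht)
  | hadd u v hu hv => intro t ht; rw [add_smul]; exact T.add_mem (hu _ ht) (hv _ ht)

theorem eq_zero_of_jrad_smul_eq_self {x : H 𝕜 m n ξ} (hx : x ∈ jrad 𝕜 m n ξ) {z : W}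
    (h : x • z = z) : z = 0 := by
  obtain ⟨u, hu⟩ := Ideal.mem_jacobson_iff.mp hx (-1)
  rw [Ideal.mem_bot] at hu
  have h1 : (u * -1 * x + u - 1) • z = -z := by
    rw [sub_smul, add_smul, mul_smul, h, mul_smul, neg_smul, one_smul, smul_neg]
    abel
  rw [hu, zero_smul, eq_comm, neg_eq_zero] at h1
  exact h1

theorem jrad_smul_eq_zero_of_c_smul (hm : 1 < m) (hn : 1 < n)
    (hξ : IsPrimitiveRoot ξ (m * n)) {μ χ : 𝕜} {z : W} (hb' : hb • z = μ • z)
    (hc' : hc • z = χ • z) (hz : hd • z = 0) {l : ℕ} (hl : ha ^ l • z = 0 ∨ l = n)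
    (hβ : ∀ i, i + 1 < l → (ξ ^ m) ^ i * χ ^ m ≠ μ) {x : H 𝕜 m n ξ} (hx : x ∈ jrad 𝕜 m n ξ) :
    x • z = 0 := by
  have hq0 : ξ ^ m ≠ 0 := pow_ne_zero _ (hξ.ne_zero (by positivity))
  have h := isWt_of_c_smul hb' hc'
  classical
  obtain ⟨f, hf⟩ := exists_smul_eq_sum hm hn hξ hb' hc' hz x
  by_contra hxz
  have hne : (Finset.univ.filter fun k : Fin n => f k • ha ^ (k : ℕ) • z ≠ 0).Nonempty := by
    by_contra hemp
    rw [Finset.not_nonempty_iff_eq_empty, Finset.filter_eq_empty_iff] at hemp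
    exact hxz (hf.symm.trans (Finset.sum_eq_zero fun k hk => not_not.mp (hemp hk)))
  set K := Finset.max' _ hne with hKdef
  have hK : f K • ha ^ (K : ℕ) • z ≠ 0 := (Finset.mem_filter.mp (Finset.max'_mem _ hne)).2
  have hKmax : ∀ k, K < k → f k • ha ^ (k : ℕ) • z = 0 := fun k hk => by
    by_contra hk'
    exact absurd (Finset.le_max' _ k (Finset.mem_filter.mpr ⟨Finset.mem_univ _, hk'⟩)) (not_le.mpr hk)
  have hKl : (K : ℕ) < l := by
    rcases hl with hl | hl
    · by_contra hlK
      apply hK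
      rw [← Nat.sub_add_cancel (not_lt.mp hlK), pow_add, mul_smul, hl, smul_zero, smul_zero]
    · rw [hl]; exact K.2
  set s := f K * ∏ i ∈ Finset.range K, qInt 𝕜 (ξ ^ m) (i + 1) * (χ ^ m - ((ξ ^ m)⁻¹) ^ i * μ)
  have hs : s ≠ 0 := by
    refine mul_ne_zero (fun h0 => hK (by rw [h0, zero_smul])) (Finset.prod_ne_zero_iff.mpr ?_)
    intro i hi
    rw [Finset.mem_range] at hi
    refine mul_ne_zero (qInt_ne_zero (isPrimitiveRoot_q hm hn hξ) (by omega) (by omega)) ?_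
    intro h0
    apply hβ i (by omega)
    rw [sub_eq_zero.mp h0, ← mul_assoc, ← mul_pow, mul_inv_cancel₀ hq0, one_pow, one_mul]
  have h1 : hd ^ (K : ℕ) • x • z = s • z := by
    rw [← hf, Finset.smul_sum, Finset.sum_eq_single K]
    · rw [smul_comm, gen_d_pow_smul_a_pow_smul hm hn hξ h hz, smul_smul]
    · intro k _ hk
      rcases lt_or_gt_of_ne hk with hk | hk
      · rw [smul_comm, gen_d_pow_smul_a_pow_smul_eq_zero hm hn hξ h hz hk, smul_zero]
      · rw [hKmax k hk, smul_zero]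
    · simp
  have h2 : s⁻¹ • (hd ^ (K : ℕ) * x) ∈ jrad 𝕜 m n ξ :=
    Submodule.smul_of_tower_mem _ _ (Ideal.mul_mem_left _ _ hx)
  have h3 : z = 0 := eq_zero_of_jrad_smul_eq_self h2 (by
    rw [smul_assoc, mul_smul, h1, smul_smul, inv_mul_cancel₀ hs, one_smul])
  exact hxz (by rw [h3, smul_zero])

theorem jrad_smul_eq_zero (hm : 1 < m) (hn : 1 < n)
    (hξ : IsPrimitiveRoot ξ (m * n)) {μ ν : 𝕜} {z : W} (h : IsWt m n ξ μ ν z)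
    (hz : hd • z = 0) {l : ℕ} (hln : l ≤ n) (hl : ha ^ l • z = 0 ∨ l = n)
    (hβ : ∀ i, i + 1 < l → (ξ ^ m) ^ i * ν ≠ μ) {x : H 𝕜 m n ξ} (hx : x ∈ jrad 𝕜 m n ξ) :
    x • z = 0 := by
  have hξ0 : ξ ≠ 0 := hξ.ne_zero (by positivity)
  have : NeZero (m * n) := ⟨by positivity⟩
  have h1 : x • z = ∑ j ∈ Finset.range (m * n), x • specProj (m * n) (ξ ^ j) hc • z := by
    rw [← Finset.smul_sum, ← Finset.sum_smul, sum_specProj hξ, one_smul]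
  rw [h1]
  refine Finset.sum_eq_zero fun j _ => ?_
  by_cases hz0 : specProj (m * n) (ξ ^ j) hc • z = 0
  · rw [hz0, smul_zero]
  have hcz := smul_specProj_pow_smul hξ0 hξ.pow_eq_one
    (gen_c_pow (𝕜 := 𝕜) (m := m) (n := n) (ξ := ξ)) j z
  have hcj := isWt_of_c_smul (smul_specProj_smul _ _ fun k => (h.c_pow_smul k).b) hcz
  have hν : (ξ ^ j) ^ m = ν := by
    have h2 := hcj.c
    rw [smul_specProj_smul _ _ fun k => (h.c_pow_smul k).c, ← sub_eq_zero, ← sub_smul,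
      smul_eq_zero, sub_eq_zero] at h2
    exact (h2.resolve_right hz0).symm
  have hdc : ∀ k, hd • hc ^ k • z = 0 := gen_d_smul_c_pow_smul_eq_zero hz
  refine jrad_smul_eq_zero_of_c_smul hm hn hξ (l := l) hcj.b hcz ?_ ?_ (fun i hi => ?_) hx
  · exact (smul_specProj_smul (r := (0 : 𝕜)) (m * n) (ξ ^ j) fun k => by
      rw [hdc, zero_smul]).trans (zero_smul 𝕜 _)
  · rcases hl with hl | hl
    · rcases hln.eq_or_lt with h' | h'
      · exact Or.inr h'
      · left
        have hac : ∀ k, ha ^ l • hc ^ k • z = 0 := fun k => by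
          induction k with
          | zero => simpa using hl
          | succ k ih =>
            rw [pow_succ' hc, mul_smul,
              gen_a_pow_smul_c_smul hm hn hξ (h.c_pow_smul k) (hdc k) h', ih, smul_zero, smul_zero]
        exact (smul_specProj_smul (r := (0 : 𝕜)) (m * n) (ξ ^ j) fun k => by
          rw [hac, zero_smul]).trans (zero_smul 𝕜 _)
    · exact Or.inr hl
  · rw [hν]; exact hβ i hi

/-- A version of `jrad_smul_eq_zero` modulo a submodule. -/
theorem jrad_smul_mem (hm : 1 < m) (hn : 1 < n)
    (hξ : IsPrimitiveRoot ξ (m * n)) (N : Submodule (H 𝕜 m n ξ) W) {μ ν : 𝕜} {z : W}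
    (h : IsWt m n ξ μ ν z)
    (hz : hd • z ∈ N) {l : ℕ} (hln : l ≤ n) (hl : ha ^ l • z ∈ N ∨ l = n)
    (hβ : ∀ i, i + 1 < l → (ξ ^ m) ^ i * ν ≠ μ) {x : H 𝕜 m n ξ} (hx : x ∈ jrad 𝕜 m n ξ) :
    x • z ∈ N := by
  rw [← Submodule.Quotient.mk_eq_zero, Submodule.Quotient.mk_smul]
  refine jrad_smul_eq_zero hm hn hξ (μ := μ) (ν := ν) (l := l) ⟨?_, ?_⟩ ?_ hln ?_ hβ hx
  · rw [← Submodule.Quotient.mk_smul, h.b]; rfl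
  · rw [← Submodule.Quotient.mk_smul, h.c]; rfl
  · rwa [← Submodule.Quotient.mk_smul, Submodule.Quotient.mk_eq_zero]
  · rwa [← Submodule.Quotient.mk_smul, Submodule.Quotient.mk_eq_zero]

end HighestWeight

/-! ### The cube of the Jacobson radical vanishes -/

section Cube

variable {W : Type*} [AddCommGroup W] [Module 𝕜 W] [Module (H 𝕜 m n ξ) W]
  [IsScalarTower 𝕜 (H 𝕜 m n ξ) W]

/-- If `d ^ t • x ∈ N` and `γ` is not the value of the Casimir element at a highest weight vector of
the weight of `d ^ s • x` for any `t₀ ≤ s < t`, then `d ^ t₀ • x ∈ N`. -/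
theorem IsWt.d_pow_smul_mem (hm : 1 < m) (hn : 1 < n) (hξ : IsPrimitiveRoot ξ (m * n))
    (N : Submodule (H 𝕜 m n ξ) W) {γ μ ν : 𝕜} {x : W} (h : IsGen m n ξ γ x)
    (hw : IsWt m n ξ μ ν x) {t₀ t : ℕ} (ht : t₀ ≤ t) (hN : hd ^ t • x ∈ N)
    (hγ : ∀ s, t₀ ≤ s → s < t → ξ ^ m * ((ξ ^ m) ^ s * μ) + (ξ ^ m)⁻¹ ^ s * ν ≠ γ) :
    hd ^ t₀ • x ∈ N := by
  induction t, ht using Nat.le_induction with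
  | base => exact hN
  | succ t ht ih =>
    refine ih ?_ fun s hs hst => hγ s hs (by omega)
    refine IsWt.mem_of_a_d_mem hm hn hξ N (hγ t ht (by omega)) (h.smul hm hn hξ _)
      (hw.d_pow_smul (hξ.ne_zero (by positivity)) t) ?_
    rw [← mul_smul hd, ← pow_succ']
    exact N.smul_mem _ hN

theorem cas_value_eq_iff {q : 𝕜} (hq : IsPrimitiveRoot q n) {μ ν : 𝕜} {s : ℕ} (hs : 0 < s)
    (hsn : s < n) : q * (q ^ s * μ) + q⁻¹ ^ s * ν = q * μ + ν ↔ q ^ (s + 1) * μ = ν := by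
  have hqs : q ^ s ≠ 0 := pow_ne_zero _ (hq.ne_zero (by omega))
  have hqs1 : q ^ s - 1 ≠ 0 := sub_ne_zero.mpr (hq.pow_ne_one_of_pos_of_lt hs.ne' hsn)
  rw [inv_pow, ← sub_eq_zero, ← sub_eq_zero (b := ν)]
  have : q * (q ^ s * μ) + (q ^ s)⁻¹ * ν - (q * μ + ν) =
      (q ^ s - 1) * (q ^ s)⁻¹ * (q ^ (s + 1) * μ - ν) := by
    field_simp
    ring
  rw [this, mul_eq_zero, mul_eq_zero]
  simp [hqs, hqs1]

theorem pow_mul_ne_self {q : 𝕜} (hq : IsPrimitiveRoot q n) {μ : 𝕜} (hμ : μ ≠ 0) {s : ℕ}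
    (hs : 0 < s) (hsn : s < n) : q ^ s * μ ≠ μ := by
  intro h
  exact hq.pow_ne_one_of_pos_of_lt hs.ne' hsn (mul_right_cancel₀ hμ (h.trans (one_mul μ).symm))

theorem jrad_mul_mem_right {x : H 𝕜 m n ξ} (hx : x ∈ jrad 𝕜 m n ξ) (y : H 𝕜 m n ξ) :
    x * y ∈ jrad 𝕜 m n ξ :=
  Ideal.mul_mem_right (I := Ideal.jacobson (⊥ : Ideal (H 𝕜 m n ξ))) y hx

theorem jrad_smul_mem_of_mem_span {S : Set W} {N : Submodule (H 𝕜 m n ξ) W}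
    (h : ∀ x ∈ jrad 𝕜 m n ξ, ∀ s ∈ S, x • s ∈ N) {x : H 𝕜 m n ξ} (hx : x ∈ jrad 𝕜 m n ξ) {u : W}
    (hu : u ∈ Submodule.span (H 𝕜 m n ξ) S) : x • u ∈ N := by
  induction hu using Submodule.span_induction generalizing x with
  | mem s hs => exact h x hx s hs
  | zero => rw [smul_zero]; exact N.zero_mem
  | add u v _ _ hu hv => rw [smul_add]; exact N.add_mem (hu hx) (hv hx)
  | smul r u _ hu => rw [← mul_smul]; exact hu (jrad_mul_mem_right hx r)

theorem jrad_cube_smul_of_linked (hm : 1 < m) (hn : 1 < n)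
    (hξ : IsPrimitiveRoot ξ (m * n)) {μ ν : 𝕜} (hμ : μ ≠ 0) (hν : ν ^ n = 1) {z : W}
    (hw : IsWt m n ξ μ ν z) (h : IsGen m n ξ (ξ ^ m * μ + ν) z) {r : ℕ} (hr : 0 < r) (hrn : r < n)
    (hrν : (ξ ^ m) ^ (r + 1) * μ = ν) {x y w : H 𝕜 m n ξ}
    (hx : x ∈ jrad 𝕜 m n ξ) (hy : y ∈ jrad 𝕜 m n ξ) (hw' : w ∈ jrad 𝕜 m n ξ) :
    x • y • w • z = 0 := by
  have hξ0 : ξ ≠ 0 := hξ.ne_zero (by positivity)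
  have hq := isPrimitiveRoot_q hm hn hξ
  have hq0 : ξ ^ m ≠ 0 := pow_ne_zero _ hξ0
  set q := ξ ^ m with hqdef
  have hμn : μ ^ n = 1 := by
    rw [← hrν, mul_pow, ← pow_mul, mul_comm, mul_comm (r + 1), pow_mul, hq.pow_eq_one, one_pow,
      mul_one] at hν
    exact hν
  have hne : ∀ s, 0 < s → s < n → s ≠ r → q * (q ^ s * μ) + q⁻¹ ^ s * ν ≠ q * μ + ν := by
    intro s hs hsn hsr
    rw [Ne, cas_value_eq_iff hq hs hsn, ← hrν]
    intro h1
    have h2 := hq.pow_inj hsn hrn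
      (mul_left_cancel₀ hq0 (by rw [← pow_succ', ← pow_succ']; exact mul_right_cancel₀ hμ h1))
    exact hsr h2
  have hdn : hd ^ n • z = 0 := by rw [gen_d_pow, zero_smul]
  have hz'w : IsWt m n ξ (q ^ r * μ) (q * μ) (hd ^ r • z) := by
    have := hw.d_pow_smul hξ0 r
    rwa [← hrν, pow_succ, ← hqdef, ← mul_assoc, ← mul_assoc, ← mul_pow, inv_mul_cancel₀ hq0,
      one_pow, one_mul] at this
  set z' := hd ^ r • z with hz'
  have hdz' : hd • z' = 0 := by
    have := hw.d_pow_smul_mem hm hn hξ ⊥ h (t₀ := r + 1) (t := n) (by omega)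
      (by rw [hdn]; exact Submodule.zero_mem _) fun s hs hsn => hne s (by omega) hsn (by omega)
    rwa [Submodule.mem_bot, pow_succ', mul_smul] at this
  have hdz : hd • z ∈ Submodule.span (H 𝕜 m n ξ) {z'} := by
    have := hw.d_pow_smul_mem hm hn hξ (Submodule.span (H 𝕜 m n ξ) {z'}) h (t₀ := 1) (t := r) hr
      (Submodule.mem_span_singleton_self z') fun s hs hsr => hne s hs (by omega) hsr.ne
    rwa [pow_one] at this
  have hqrn : q⁻¹ ^ r * q ^ r = 1 := by rw [← mul_pow, inv_mul_cancel₀ hq0, one_pow]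
  have han : ∀ k, (q ^ k * μ) ^ n = 1 := fun k => by
    rw [mul_pow, ← pow_mul, mul_comm k, pow_mul, hq.pow_eq_one, one_pow, hμn, mul_one]
  set w₁ := ha ^ r • z' with hw₁
  have hw₁w : IsWt m n ξ μ ν w₁ := by
    have := hz'w.a_pow_smul hm hn hξ r
    rwa [← hqdef, ← mul_assoc, hqrn, one_mul, ← mul_assoc, ← pow_succ, hrν] at this
  have hdw₁ : hd • w₁ = 0 := by
    obtain ⟨r', rfl⟩ := Nat.exists_eq_succ_of_ne_zero hr.ne'
    rw [hw₁, hz'w.d_smul_a_pow_smul hm hn hξ, hdz', smul_zero, zero_add]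
    have : q * μ - q⁻¹ ^ r' * (q ^ r'.succ * μ) = 0 := by
      rw [Nat.succ_eq_add_one, pow_succ, ← mul_assoc, ← mul_assoc, ← mul_pow, inv_mul_cancel₀ hq0,
        one_pow, one_mul, sub_self]
    rw [← hqdef, this, mul_zero, zero_smul]
  have hβ₁ : ∀ i, i + 1 < n - r → q ^ i * ν ≠ μ := fun i hi => by
    rw [← hrν, ← mul_assoc, ← pow_add]
    exact pow_mul_ne_self hq hμ (by omega) (by omega)
  have hβ₂ : ∀ i, i + 1 < r → q ^ i * (q * μ) ≠ q ^ r * μ := fun i hi h0 => by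
    rw [← mul_assoc, ← pow_succ] at h0
    have := hq.pow_inj (by omega) (by omega) (mul_right_cancel₀ hμ h0)
    omega
  have hJw₁ : ∀ x ∈ jrad 𝕜 m n ξ, x • w₁ = 0 := fun x hx => by
    refine jrad_smul_eq_zero hm hn hξ hw₁w hdw₁ (Nat.sub_le n r) (Or.inl ?_) hβ₁ hx
    rw [hw₁, ← mul_smul, ← pow_add, Nat.sub_add_cancel hrn.le, hz'w.a_pow_n_smul, han, sub_self,
      zero_smul]
  set N₂ := Submodule.span (H 𝕜 m n ξ) {w₁} with hN₂
  have hw₁N : w₁ ∈ N₂ := Submodule.mem_span_singleton_self w₁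
  have hJz' : ∀ x ∈ jrad 𝕜 m n ξ, x • z' ∈ N₂ := fun x hx =>
    jrad_smul_mem hm hn hξ N₂ hz'w (by rw [hdz']; exact N₂.zero_mem) hrn.le (Or.inl hw₁N) hβ₂ hx
  have had : ha • hd • z ∈ N₂ := by
    suffices H0 : ∀ k, k < r → ha ^ (r - k) • hd ^ (r - k) • z ∈ N₂ by
      have := H0 (r - 1) (by omega)
      rwa [Nat.sub_sub_self hr, pow_one, pow_one] at this
    intro k
    induction k with
    | zero => intro _; exact hw₁N
    | succ k ih =>
      intro hk
      obtain ⟨s, hs⟩ : ∃ s, r - k = s + 1 := ⟨r - k - 1, by omega⟩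
      have ih' := ih (by omega)
      rw [show r - (k + 1) = s by omega]
      rw [hs] at ih'
      refine ((h.smul hm hn hξ _).smul hm hn hξ _).mem_of_cas_smul_sub_mem hm hn hξ N₂
        (hne s (by omega) (by omega) (by omega)) ?_
      rw [cas_smul_smul hm hn hξ, (hw.d_pow_smul hξ0 s).cas_smul, smul_add, ← hqdef,
        smul_comm (ha ^ s) (1 - q), smul_comm (ha ^ s) (_ + _ : 𝕜), add_sub_cancel_right]
      rw [← mul_smul hd, ← pow_succ', ← mul_smul (ha ^ s), ← pow_succ]
      exact N₂.smul_of_tower_mem _ ih'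
  set y₁ := ha ^ (n - r) • z with hy₁
  have hinv : q⁻¹ ^ (n - r) = q ^ r := by
    rw [inv_pow]
    refine inv_eq_of_mul_eq_one_right ?_
    rw [← pow_add, Nat.sub_add_cancel hrn.le, hq.pow_eq_one]
  have hy₁w : IsWt m n ξ (q ^ r * μ) (q * μ) y₁ := by
    have := hw.a_pow_smul hm hn hξ (n - r)
    rwa [← hqdef, hinv, ← hrν, ← mul_assoc, ← pow_add,
      show n - r + (r + 1) = n + 1 by omega, pow_succ, hq.pow_eq_one, one_mul] at this
  have hdy₁ : hd • y₁ ∈ N₂ := by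
    obtain ⟨l, hl⟩ : ∃ l, n - r = l + 1 := ⟨n - r - 1, by omega⟩
    rw [hy₁, hl, hw.d_smul_a_pow_smul hm hn hξ]
    have : ν - q⁻¹ ^ l * μ = 0 := by
      rw [← hrν, ← sub_mul, inv_pow, sub_eq_zero.mpr, zero_mul]
      refine (inv_eq_of_mul_eq_one_right ?_).symm
      rw [← pow_add, show l + (r + 1) = n by omega, hq.pow_eq_one]
    rw [← hqdef, this, mul_zero, zero_smul, add_zero, pow_succ, mul_smul]
    exact N₂.smul_mem _ had
  have hJy₁ : ∀ x ∈ jrad 𝕜 m n ξ, x • y₁ ∈ N₂ := fun x hx => by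
    refine jrad_smul_mem hm hn hξ N₂ hy₁w hdy₁ hrn.le (Or.inl ?_) hβ₂ hx
    rw [hy₁, ← mul_smul, ← pow_add, Nat.add_sub_cancel' hrn.le, hw.a_pow_n_smul, hμn, sub_self,
      zero_smul]
    exact N₂.zero_mem
  have hJz : w • z ∈ Submodule.span (H 𝕜 m n ξ) {z', y₁} :=
    jrad_smul_mem hm hn hξ _ hw (Submodule.span_mono (by simp) hdz) (Nat.sub_le n r)
      (Or.inl (Submodule.subset_span (by simp [hy₁]))) hβ₁ hw'
  have h1 : y • w • z ∈ N₂ := jrad_smul_mem_of_mem_span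
    (fun x hx s hs => by
      rcases hs with rfl | rfl
      · exact hJz' x hx
      · exact hJy₁ x hx) hy hJz
  rw [← Submodule.mem_bot (H 𝕜 m n ξ)]
  exact jrad_smul_mem_of_mem_span
    (fun x hx s hs => by rw [Set.mem_singleton_iff.mp hs, hJw₁ x hx]; exact Submodule.zero_mem _)
    hx h1

theorem jrad_cube_smul_of_cas_value (hm : 1 < m) (hn : 1 < n)
    (hξ : IsPrimitiveRoot ξ (m * n)) {μ ν : 𝕜} (hμ : μ ≠ 0) (hν : ν ^ n = 1) {z : W}
    (hw : IsWt m n ξ μ ν z) (h : IsGen m n ξ (ξ ^ m * μ + ν) z) {x y w : H 𝕜 m n ξ}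
    (hx : x ∈ jrad 𝕜 m n ξ) (hy : y ∈ jrad 𝕜 m n ξ) (hw' : w ∈ jrad 𝕜 m n ξ) :
    x • y • w • z = 0 := by
  have hq := isPrimitiveRoot_q hm hn hξ
  by_cases hr : ∃ r, 0 < r ∧ r < n ∧ (ξ ^ m) ^ (r + 1) * μ = ν
  · obtain ⟨r, hr, hrn, hrν⟩ := hr
    exact jrad_cube_smul_of_linked hm hn hξ hμ hν hw h hr hrn hrν hx hy hw'
  push Not at hr
  have hdz : hd • z = 0 := by
    have := hw.d_pow_smul_mem hm hn hξ ⊥ h (t₀ := 1) (t := n) hn.le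
      (by rw [gen_d_pow, zero_smul]; exact Submodule.zero_mem _)
      fun s hs hsn => (cas_value_eq_iff hq hs hsn).not.mpr (hr s hs hsn)
    rwa [Submodule.mem_bot, pow_one] at this
  rw [jrad_smul_eq_zero hm hn hξ hw hdz le_rfl (Or.inr rfl) (fun i hi h0 => ?_) hw', smul_zero,
    smul_zero]
  refine hr (n - 1 - i) (by omega) (by omega) ?_
  rw [← h0, ← mul_assoc, ← pow_add, show n - 1 - i + 1 + i = n by omega, hq.pow_eq_one, one_mul]

theorem jrad_cube_smul_of_isGen (hm : 1 < m) (hn : 1 < n)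
    (hξ : IsPrimitiveRoot ξ (m * n)) {μ ν : 𝕜} (hμ : μ ≠ 0) (hν : ν ^ n = 1) {γ : 𝕜} {v : W}
    (hw : IsWt m n ξ μ ν v) (h : IsGen m n ξ γ v) {x y w : H 𝕜 m n ξ}
    (hx : x ∈ jrad 𝕜 m n ξ) (hy : y ∈ jrad 𝕜 m n ξ) (hw' : w ∈ jrad 𝕜 m n ξ) :
    x • y • w • v = 0 := by
  classical
  have hξ0 : ξ ≠ 0 := hξ.ne_zero (by positivity)
  have hq := isPrimitiveRoot_q hm hn hξ
  by_cases ht : ∃ t, ξ ^ m * ((ξ ^ m) ^ t * μ) + (ξ ^ m)⁻¹ ^ t * ν = γ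
  · have hmin := fun s (hs : s < Nat.find ht) => Nat.find_min ht hs
    have hspec := Nat.find_spec ht
    set t := Nat.find ht
    have h1 := hw.d_pow_smul_mem hm hn hξ (Submodule.span (H 𝕜 m n ξ) {hd ^ t • v}) h
      (Nat.zero_le t) (Submodule.mem_span_singleton_self _) fun s _ hs => hmin s hs
    rw [pow_zero, one_smul, Submodule.mem_span_singleton] at h1
    obtain ⟨u, hu⟩ := h1
    rw [← hu, ← mul_smul w]
    have hνt : ((ξ ^ m)⁻¹ ^ t * ν) ^ n = 1 := by
      rw [mul_pow, hν, mul_one, ← pow_mul, mul_comm, pow_mul, inv_pow, hq.pow_eq_one, inv_one,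
        one_pow]
    refine jrad_cube_smul_of_cas_value hm hn hξ
      (mul_ne_zero (pow_ne_zero _ (pow_ne_zero _ hξ0)) hμ) hνt
      (hw.d_pow_smul hξ0 t) ?_ hx hy (jrad_mul_mem_right hw' u)
    rw [hspec]
    exact h.smul hm hn hξ _
  · push Not at ht
    have h1 := hw.d_pow_smul_mem hm hn hξ ⊥ h (Nat.zero_le n)
      (by rw [gen_d_pow, zero_smul]; exact Submodule.zero_mem _) fun s _ _ => ht s
    rw [pow_zero, one_smul, Submodule.mem_bot] at h1
    rw [h1, smul_zero, smul_zero, smul_zero]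

open Polynomial in
theorem aeval_cas_mul (hm : 1 < m) (hn : 1 < n) (hξ : IsPrimitiveRoot ξ (m * n)) (P : 𝕜[X])
    (x : H 𝕜 m n ξ) : aeval (cas 𝕜 m n ξ) P * x = x * aeval (cas 𝕜 m n ξ) P := by
  induction P using Polynomial.induction_on' with
  | add p q hp hq => rw [map_add, add_mul, mul_add, hp, hq]
  | monomial k r =>
    rw [aeval_monomial]
    exact Commute.mul_left (Algebra.commutes r x) (Commute.pow_left (cas_mul hm hn hξ x) k)

open Polynomial in
theorem jrad_cube_smul_of_aeval [IsAlgClosed 𝕜] (hm : 1 < m) (hn : 1 < n)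
    (hξ : IsPrimitiveRoot ξ (m * n)) {μ ν : 𝕜} (hμ : μ ≠ 0) (hν : ν ^ n = 1) {P : 𝕜[X]}
    (hP : P ≠ 0) {v : W} (hw : IsWt m n ξ μ ν v) (h : aeval (cas 𝕜 m n ξ) P • v = 0)
    {x y w : H 𝕜 m n ξ} (hx : x ∈ jrad 𝕜 m n ξ) (hy : y ∈ jrad 𝕜 m n ξ)
    (hw' : w ∈ jrad 𝕜 m n ξ) : x • y • w • v = 0 := by
  induction hN : P.natDegree using Nat.strong_induction_on generalizing P v with
  | _ N ih =>
  have hwt : ∀ R : 𝕜[X], IsWt m n ξ μ ν (aeval (cas 𝕜 m n ξ) R • v) := fun R =>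
    ⟨by rw [← mul_smul, ← aeval_cas_mul hm hn hξ, mul_smul, hw.b, smul_comm],
      by rw [← mul_smul, ← aeval_cas_mul hm hn hξ, mul_smul, hw.c, smul_comm]⟩
  by_cases hdeg : P.degree = 0
  · rw [eq_C_of_degree_eq_zero hdeg, aeval_C, algebraMap_smul, smul_eq_zero] at h
    rcases h with h | h
    · exact absurd (by rw [eq_C_of_degree_eq_zero hdeg, h, C_0]) hP
    · rw [h, smul_zero, smul_zero, smul_zero]
  obtain ⟨γ, hγ⟩ := IsAlgClosed.exists_root P hdeg
  obtain ⟨Q, hQ, hQγ⟩ := exists_eq_pow_rootMultiplicity_mul_and_not_dvd P hP γ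
  set k := P.rootMultiplicity γ with hk
  have hk0 : 0 < k := (rootMultiplicity_pos hP).mpr hγ
  have hQ0 : Q ≠ 0 := by rintro rfl; exact hQγ (dvd_zero _)
  have hcop : IsCoprime ((X - C γ) ^ k) Q :=
    (((irreducible_X_sub_C γ).coprime_iff_not_dvd).mpr hQγ).pow_left
  obtain ⟨A, B, hAB⟩ := hcop
  have hsplit : v = aeval (cas 𝕜 m n ξ) (A * (X - C γ) ^ k) • v +
      aeval (cas 𝕜 m n ξ) (B * Q) • v := by
    rw [← add_smul, ← map_add, hAB, map_one, one_smul]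
  rw [hsplit, smul_add, smul_add, smul_add]
  have h1 : x • y • w • aeval (cas 𝕜 m n ξ) (A * (X - C γ) ^ k) • v = 0 := by
    refine ih Q.natDegree ?_ hQ0 (hwt _) ?_ rfl
    · rw [← hN, hQ, natDegree_mul (pow_ne_zero _ (X_sub_C_ne_zero γ)) hQ0, natDegree_pow,
        natDegree_X_sub_C]
      omega
    · rw [← mul_smul, ← map_mul, show Q * (A * (X - C γ) ^ k) = A * ((X - C γ) ^ k * Q) by ring,
        ← hQ, map_mul, mul_smul, h, smul_zero]
  have h2 : x • y • w • aeval (cas 𝕜 m n ξ) (B * Q) • v = 0 := by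
    refine jrad_cube_smul_of_isGen (γ := γ) hm hn hξ hμ hν (hwt _) ⟨k, ?_⟩ hx hy hw'
    have h3 : (cas 𝕜 m n ξ - algebraMap 𝕜 _ γ) ^ k = aeval (cas 𝕜 m n ξ) ((X - C γ) ^ k) := by
      rw [map_pow, map_sub, aeval_X, aeval_C]
    rw [h3, ← mul_smul, ← map_mul, show (X - C γ) ^ k * (B * Q) = B * ((X - C γ) ^ k * Q) by ring,
      ← hQ, map_mul, mul_smul, h, smul_zero]
  rw [h1, h2, add_zero]

open Polynomial in
theorem IsWt.exists_aeval_cas_smul_eq (hm : 1 < m) (hn : 1 < n)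
    (hξ : IsPrimitiveRoot ξ (m * n)) {μ ν : 𝕜} {v : W} (hw : IsWt m n ξ μ ν v) (k : ℕ) :
    ∃ P : 𝕜[X], P.Monic ∧
      aeval (cas 𝕜 m n ξ) P • v = (1 - ξ ^ m) ^ k • ha ^ k • hd ^ k • v := by
  induction k with
  | zero => exact ⟨1, monic_one, by simp⟩
  | succ k ih =>
    obtain ⟨P, hP, h⟩ := ih
    have hwk := hw.d_pow_smul (hξ.ne_zero (by positivity)) k
    refine ⟨(X - C (ξ ^ m * ((ξ ^ m) ^ k * μ) + (ξ ^ m)⁻¹ ^ k * ν)) * P,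
      (monic_X_sub_C _).mul hP, ?_⟩
    rw [map_mul, mul_smul, h, map_sub, aeval_X, aeval_C, smul_comm, sub_smul,
      cas_smul_smul hm hn hξ, hwk.cas_smul, algebraMap_smul, smul_add, smul_comm (ha ^ k) (1 - ξ ^ m),
      smul_comm (ha ^ k) (_ + _ : 𝕜), add_sub_cancel_right, smul_smul, ← pow_succ]
    rw [← mul_smul hd, ← pow_succ', ← mul_smul (ha ^ k), ← pow_succ]

theorem jrad_cube [IsAlgClosed 𝕜] (hm : 1 < m) (hn : 1 < n) (hξ : IsPrimitiveRoot ξ (m * n))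
    {x y w : H 𝕜 m n ξ} (hx : x ∈ jrad 𝕜 m n ξ) (hy : y ∈ jrad 𝕜 m n ξ)
    (hw : w ∈ jrad 𝕜 m n ξ) : x * y * w = 0 := by
  have hξ0 : ξ ≠ 0 := hξ.ne_zero (by positivity)
  have : NeZero (m * n) := ⟨by positivity⟩
  have h1 : (1 : H 𝕜 m n ξ) = ∑ i ∈ Finset.range (m * n), ∑ j ∈ Finset.range (m * n),
      specProj (m * n) (ξ ^ i) hb • specProj (m * n) (ξ ^ j) hc • (1 : H 𝕜 m n ξ) := by
    simp only [smul_eq_mul, mul_one]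
    rw [← Finset.sum_mul_sum, sum_specProj hξ, sum_specProj hξ, mul_one]
  suffices H0 : ∀ i j, x • y • w •
      specProj (m * n) (ξ ^ i) hb • specProj (m * n) (ξ ^ j) hc • (1 : H 𝕜 m n ξ) = 0 by
    have h2 : x * y * w = x • y • w • (1 : H 𝕜 m n ξ) := by
      simp only [smul_eq_mul, mul_one, mul_assoc]
    rw [h2, h1]
    simp only [Finset.smul_sum]
    exact Finset.sum_eq_zero fun i _ => Finset.sum_eq_zero fun j _ => H0 i j
  intro i j
  have hwt : IsWt m n ξ (ξ ^ i) ((ξ ^ j) ^ m)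
      (specProj (m * n) (ξ ^ i) hb • specProj (m * n) (ξ ^ j) hc • (1 : H 𝕜 m n ξ)) := by
    refine isWt_of_c_smul (smul_specProj_pow_smul hξ0 hξ.pow_eq_one gen_b_pow i _)
      (smul_specProj_smul _ _ fun k => ?_)
    rw [← mul_smul, ← (Commute.pow_left (gen_bc : Commute _ _) k).eq, mul_smul,
      smul_specProj_pow_smul hξ0 hξ.pow_eq_one gen_c_pow, smul_comm]
  obtain ⟨P, hP, hP0⟩ := hwt.exists_aeval_cas_smul_eq hm hn hξ n
  rw [gen_d_pow, zero_smul, smul_zero, smul_zero] at hP0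
  refine jrad_cube_smul_of_aeval hm hn hξ (pow_ne_zero i hξ0) ?_ hP.ne_zero hwt hP0 hx hy hw
  rw [← pow_mul, ← pow_mul, mul_comm, pow_mul, hξ.pow_eq_one, one_pow]

end Cube

/-! ### Projectivity of the induced modules -/

section Projective

variable {W : Type*} [AddCommGroup W] [Module 𝕜 W] [Module (H 𝕜 m n ξ) W]
  [IsScalarTower 𝕜 (H 𝕜 m n ξ) W]

theorem gen_d_smul_b_pow_smul_eq_zero (hξ0 : ξ ≠ 0) {x : W} (hx : hd • x = 0) (k : ℕ) :
    hd • hb ^ k • x = 0 := by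
  induction k with
  | zero => simpa using hx
  | succ k ih =>
    have h := gen_b_smul_d_smul (𝕜 := 𝕜) (m := m) (n := n) (ξ := ξ) (hb ^ k • x)
    rw [ih, smul_zero, eq_comm, smul_eq_zero] at h
    rw [pow_succ', mul_smul]
    exact h.resolve_left (pow_ne_zero _ hξ0)

theorem gen_d_smul_specProj_smul_eq_zero (hξ0 : ξ ≠ 0) (N N' : ℕ) (ζ ζ' : 𝕜) {x : W}
    (hx : hd • x = 0) : hd • specProj N ζ hb • specProj N' ζ' hc • x = 0 := by
  have h1 : hd • specProj N' ζ' hc • x = 0 :=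
    (smul_specProj_smul (r := (0 : 𝕜)) N' ζ' fun k => by
      rw [gen_d_smul_c_pow_smul_eq_zero hx, zero_smul]).trans (zero_smul 𝕜 _)
  exact (smul_specProj_smul (r := (0 : 𝕜)) N ζ fun k => by
      rw [gen_d_smul_b_pow_smul_eq_zero hξ0 h1, zero_smul]).trans (zero_smul 𝕜 _)

theorem gen_b_smul_specProj_smul {ζ : 𝕜} (hζ0 : ζ ≠ 0) (hζ : ζ ^ (m * n) = 1) (x : W) :
    hb • specProj (m * n) ζ hb • x = ζ • specProj (m * n) ζ hb • x := by
  rw [← mul_smul, mul_specProj hζ0 hζ gen_b_pow, smul_assoc]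

theorem gen_c_smul_specProj_smul {ζ : 𝕜} (hζ0 : ζ ≠ 0) (hζ : ζ ^ (m * n) = 1) (ζ' : 𝕜) (x : W) :
    hc • specProj (m * n) ζ' hb • specProj (m * n) ζ hc • x =
      ζ • specProj (m * n) ζ' hb • specProj (m * n) ζ hc • x := by
  refine smul_specProj_smul _ _ fun k => ?_
  have hcb : hc * hb ^ k = hb ^ k * hc := Commute.pow_right gen_bc.symm k
  rw [← mul_smul, hcb, mul_smul, ← mul_smul hc (specProj _ _ _),
    mul_specProj hζ0 hζ gen_c_pow, smul_assoc, smul_comm]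

/-- A module freely spanned by the `a ^ k • z`, for an eigenvector `z` of `b` and `c` killed by `d`,
is projective if `d ^ (n - 1) * a ^ (n - 1)` does not kill `z`. -/
theorem projective_of_eigenvector {V : Type} [AddCommGroup V] [Module 𝕜 V] [Module (H 𝕜 m n ξ) V]
    [IsScalarTower 𝕜 (H 𝕜 m n ξ) V] (hm : 1 < m) (hn : 1 < n)
    (hξ : IsPrimitiveRoot ξ (m * n)) {μ χ : 𝕜} (hμ : μ ^ (m * n) = 1) (hχ : χ ^ (m * n) = 1)
    (h : ∀ k, k ≤ n - 2 → (ξ ^ m) ^ k * χ ^ m ≠ μ) {z : V} (hbz : hb • z = μ • z)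
    (hcz : hc • z = χ • z) (hdz : hd • z = 0)
    (hli : LinearIndependent 𝕜 (fun k : Fin n => (ha ^ (k : ℕ)) • z))
    (hspan : Submodule.span 𝕜 (Set.range fun k : Fin n => (ha ^ (k : ℕ)) • z) = ⊤) :
    Module.Projective (H 𝕜 m n ξ) V := by
  have hξ0 : ξ ≠ 0 := hξ.ne_zero (by positivity)
  have hq0 : ξ ^ m ≠ 0 := pow_ne_zero _ hξ0
  have hmn : m * n ≠ 0 := by positivity
  have : NeZero (m * n) := ⟨hmn⟩
  have hN : ((m * n : ℕ) : 𝕜) ≠ 0 := hξ.neZero'.out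
  have hμ0 : μ ≠ 0 := by rintro rfl; simp [hmn] at hμ
  have hχ0 : χ ≠ 0 := by rintro rfl; simp [hmn] at hχ
  set s : H 𝕜 m n ξ :=
    specProj (m * n) μ hb • specProj (m * n) χ hc • hd ^ (n - 1) • ha ^ (n - 1) with hs
  have hds : hd • s = 0 := by
    refine gen_d_smul_specProj_smul_eq_zero hξ0 _ _ _ _ ?_
    rw [← mul_smul, ← pow_succ', Nat.sub_add_cancel hn.le, gen_d_pow, zero_smul]
  set π : 𝕜 := ∏ i ∈ Finset.range (n - 1),
    qInt 𝕜 (ξ ^ m) (i + 1) * (χ ^ m - ((ξ ^ m)⁻¹) ^ i * μ) with hπ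
  have hπ0 : π ≠ 0 := by
    refine Finset.prod_ne_zero_iff.mpr fun i hi => ?_
    rw [Finset.mem_range] at hi
    refine mul_ne_zero (qInt_ne_zero (isPrimitiveRoot_q hm hn hξ) i.succ_pos (by omega)) fun h0 => ?_
    refine h i (by omega) ?_
    rw [sub_eq_zero.mp h0, ← mul_assoc, ← mul_pow, mul_inv_cancel₀ hq0, one_pow, one_mul]
  have hsz : s • z = π • z := by
    simp only [hs, smul_assoc]
    rw [gen_d_pow_smul_a_pow_smul hm hn hξ (isWt_of_c_smul hbz hcz) hdz, ← hπ,
      smul_comm (specProj (m * n) χ hc) π, specProj_smul hN hχ0 hcz,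
      smul_comm (specProj (m * n) μ hb) π, specProj_smul hN hμ0 hbz]
  have hker : ∀ g : H 𝕜 m n ξ, g • z = 0 → g • s = 0 := by
    intro g hg
    obtain ⟨f, hf⟩ := exists_smul_eq_sum (x := ((z, s) : V × H 𝕜 m n ξ)) hm hn hξ
      (μ := μ) (χ := χ) (Prod.ext hbz (gen_b_smul_specProj_smul hμ0 hμ _))
      (Prod.ext hcz (gen_c_smul_specProj_smul hχ0 hχ _ _)) (Prod.ext hdz hds) g
    have h1 := congrArg Prod.fst hf
    have h2 := congrArg Prod.snd hf
    simp only [Prod.fst_sum, Prod.snd_sum, Prod.smul_fst, Prod.smul_snd] at h1 h2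
    rw [hg] at h1
    have h3 := Fintype.linearIndependent_iff.mp hli f h1
    rw [← h2]
    exact Finset.sum_eq_zero fun k _ => by rw [h3 k, zero_smul]
  let φ := LinearMap.toSpanSingleton (H 𝕜 m n ξ) V z
  let ψ := LinearMap.toSpanSingleton (H 𝕜 m n ξ) (H 𝕜 m n ξ) s
  have hφ : Function.Surjective φ := by
    intro v
    have hv : v ∈ Submodule.span 𝕜 (Set.range fun k : Fin n => (ha ^ (k : ℕ)) • z) := by
      rw [hspan]; trivial
    obtain ⟨c, rfl⟩ := (Submodule.mem_span_range_iff_exists_fun 𝕜).mp hv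
    refine ⟨∑ k, c k • ha ^ (k : ℕ), ?_⟩
    rw [LinearMap.toSpanSingleton_apply, Finset.sum_smul]
    simp only [smul_assoc]
  have hle : LinearMap.ker φ ≤ LinearMap.ker ψ := fun g hg => hker g hg
  let σ : V →ₗ[H 𝕜 m n ξ] H 𝕜 m n ξ :=
    ((LinearMap.ker φ).liftQ ψ hle).comp (φ.quotKerEquivOfSurjective hφ).symm.toLinearMap
  have hσ : ∀ g : H 𝕜 m n ξ, σ (g • z) = g • s := by
    intro g
    have h1 : (φ.quotKerEquivOfSurjective hφ).symm (g • z) = Submodule.Quotient.mk g := by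
      rw [LinearEquiv.symm_apply_eq]; rfl
    change (LinearMap.ker φ).liftQ ψ hle ((φ.quotKerEquivOfSurjective hφ).symm (g • z)) = _
    rw [h1]; rfl
  refine Module.Projective.of_split σ (LinearMap.toSpanSingleton (H 𝕜 m n ξ) V (π⁻¹ • z)) ?_
  ext v
  obtain ⟨g, rfl⟩ := hφ v
  change σ (g • z) • π⁻¹ • z = g • z
  rw [hσ, smul_assoc, smul_comm s, hsz, smul_smul, inv_mul_cancel₀ hπ0, one_smul]

end Projective

/-! ### Two elements of the Jacobson radical -/

theorem mem_jrad_of_isSimpleModule {x : H 𝕜 m n ξ}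
    (h : ∀ (S : Type) [AddCommGroup S] [Module 𝕜 S] [Module (H 𝕜 m n ξ) S]
      [IsScalarTower 𝕜 (H 𝕜 m n ξ) S] [IsSimpleModule (H 𝕜 m n ξ) S] (u : S), x • u = 0) :
    x ∈ jrad 𝕜 m n ξ := by
  rw [jrad, Ideal.jacobson, Submodule.mem_sInf]
  rintro I ⟨-, hI⟩
  have : IsSimpleModule (H 𝕜 m n ξ) (H 𝕜 m n ξ ⧸ I) := isSimpleModule_iff_isCoatom.mpr hI.out
  have h1 := h (H 𝕜 m n ξ ⧸ I) (Submodule.Quotient.mk 1)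
  rwa [← Submodule.Quotient.mk_smul, Submodule.Quotient.mk_eq_zero, smul_eq_mul, mul_one] at h1

theorem inv_pow_pred_eq_self {q : 𝕜} (hq : IsPrimitiveRoot q n) (hn : 0 < n) :
    q⁻¹ ^ (n - 1) = q := by
  rw [inv_pow]
  refine inv_eq_of_mul_eq_one_right ?_
  rw [← pow_succ, Nat.sub_add_cancel hn, hq.pow_eq_one]

section Simple

variable {W : Type*} [AddCommGroup W] [Module 𝕜 W] [Module (H 𝕜 m n ξ) W]
  [IsScalarTower 𝕜 (H 𝕜 m n ξ) W]

theorem gen_a_smul_smul_eq_zero_and (hm : 1 < m) (hn : 1 < n) (hξ : IsPrimitiveRoot ξ (m * n))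
    {w : W} (ha' : ha • w = 0) (hd' : hd • w = 0) (x : H 𝕜 m n ξ) :
    ha • x • w = 0 ∧ hd • x • w = 0 := by
  have hξ0 : ξ ≠ 0 := hξ.ne_zero (by positivity)
  induction x using H_induction generalizing w with
  | h0 r => simp only [algebraMap_smul, smul_comm _ r, ha', hd', smul_zero, and_self]
  | ha' => simp only [ha', smul_zero, and_self]
  | hb' =>
    have h1 := gen_b_smul_a_smul (𝕜 := 𝕜) (m := m) (n := n) hξ0 w
    have h2 := gen_b_smul_d_smul (𝕜 := 𝕜) (m := m) (n := n) (ξ := ξ) w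
    rw [ha', smul_zero, eq_comm, smul_eq_zero] at h1
    rw [hd', smul_zero, eq_comm, smul_eq_zero] at h2
    exact ⟨h1.resolve_left (inv_ne_zero (pow_ne_zero _ hξ0)), h2.resolve_left (pow_ne_zero _ hξ0)⟩
  | hc' =>
    have h1 : hd ^ (n - 1) • w = 0 := by
      obtain ⟨k, hk⟩ : ∃ k, n - 1 = k + 1 := ⟨n - 2, by omega⟩
      rw [hk, pow_succ, mul_smul, hd', smul_zero]
    rw [gen_a_smul_c_smul h1, gen_d_smul_c_smul, ha', hd']
    simp only [smul_zero, and_self]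
  | hd' => simp only [hd', smul_zero, and_self]
  | hmul x y hx hy =>
    rw [mul_smul]
    exact hx (hy ha' hd').1 (hy ha' hd').2
  | hadd x y hx hy =>
    simp only [add_smul, smul_add, (hx ha' hd').1, (hx ha' hd').2, (hy ha' hd').1, (hy ha' hd').2,
      add_zero, and_self]

variable [IsSimpleModule (H 𝕜 m n ξ) W]

theorem gen_a_smul_eq_zero_and (hm : 1 < m) (hn : 1 < n) (hξ : IsPrimitiveRoot ξ (m * n))
    {w : W} (hw : w ≠ 0) (ha' : ha • w = 0) (hd' : hd • w = 0) (u : W) :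
    ha • u = 0 ∧ hd • u = 0 := by
  obtain ⟨x, rfl⟩ := IsSimpleModule.toSpanSingleton_surjective (H 𝕜 m n ξ) hw u
  exact gen_a_smul_smul_eq_zero_and hm hn hξ ha' hd' x

theorem cas_smul_eq_of_isSimpleModule (hm : 1 < m) (hn : 1 < n) (hξ : IsPrimitiveRoot ξ (m * n))
    {γ : 𝕜} {w : W} (hw : w ≠ 0) (h : cas 𝕜 m n ξ • w = γ • w) (u : W) :
    cas 𝕜 m n ξ • u = γ • u := by
  obtain ⟨x, rfl⟩ := IsSimpleModule.toSpanSingleton_surjective (H 𝕜 m n ξ) hw u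
  rw [LinearMap.toSpanSingleton_apply, cas_smul_smul hm hn hξ, h, smul_comm]

theorem gen_d_pow_smul_eq_zero_of_isSimpleModule (hm : 1 < m) (hn : 1 < n)
    (hξ : IsPrimitiveRoot ξ (m * n)) {u : W} (hbu : hb • u = u) (hcu : hc • u = u) :
    hd ^ (n - 1) • u = 0 := by
  have hξ0 : ξ ≠ 0 := hξ.ne_zero (by positivity)
  have hq := isPrimitiveRoot_q hm hn hξ
  have hq0 : ξ ^ m ≠ 0 := pow_ne_zero _ hξ0
  have hu : IsWt m n ξ 1 1 u := by
    simpa using isWt_of_c_smul (𝕜 := 𝕜) (m := m) (n := n) (ξ := ξ) (χ := 1) (μ := 1) (x := u)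
      (by rwa [one_smul]) (by rwa [one_smul])
  by_contra hz
  set z := hd ^ (n - 1) • u with hzdef
  have hwz := hu.d_pow_smul hξ0 (n - 1)
  rw [← hzdef, mul_one, mul_one] at hwz
  have hdz : hd • z = 0 := by
    rw [hzdef, ← mul_smul, ← pow_succ', Nat.sub_add_cancel hn.le, gen_d_pow, zero_smul]
  have hcz : hc • z = (ξ⁻¹) ^ (n - 1) • z := by
    have h1 : hd ^ (n - 1) • hc • u = ξ ^ (n - 1) • hc • z := by
      rw [← mul_smul, gen_d_pow_mul_c, smul_assoc, mul_smul]
    rw [hcu, ← hzdef] at h1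
    rw [congrArg ((ξ⁻¹ ^ (n - 1)) • ·) h1]
    simp only [smul_smul]
    rw [← mul_pow, inv_mul_cancel₀ hξ0, one_pow, one_smul]
  by_cases hw : ha ^ (n - 1) • z = 0
  · obtain ⟨x, hx⟩ := IsSimpleModule.toSpanSingleton_surjective (H 𝕜 m n ξ) hz u
    obtain ⟨f, hf⟩ := exists_smul_eq_sum hm hn hξ hwz.b hcz hdz x
    rw [LinearMap.toSpanSingleton_apply, ← hf] at hx
    refine hz ?_
    rw [hzdef, ← hx, Finset.smul_sum]
    refine Finset.sum_eq_zero fun k _ => ?_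
    rw [smul_comm]
    rcases Nat.lt_or_ge (k : ℕ) (n - 1) with hk | hk
    · rw [gen_d_pow_smul_a_pow_smul_eq_zero hm hn hξ hwz hdz hk, smul_zero]
    · rw [show (k : ℕ) = n - 1 by omega, hw, smul_zero, smul_zero]
  · refine hz ?_
    have h1 : ha • ha ^ (n - 1) • z = 0 := by
      rw [← mul_smul, ← pow_succ', Nat.sub_add_cancel hn.le, hwz.a_pow_n_smul, ← pow_mul, mul_comm,
        pow_mul, hq.pow_eq_one, one_pow, sub_self, zero_smul]
    have h2 : hd • ha ^ (n - 1) • z = 0 := by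
      obtain ⟨k, rfl⟩ : ∃ k, n = k + 2 := ⟨n - 2, by omega⟩
      rw [show k + 2 - 1 = k + 1 by omega] at *
      rw [hwz.d_smul_a_pow_smul hm hn hξ, hdz, smul_zero, zero_add, pow_succ (ξ ^ m), ← mul_assoc,
        ← mul_pow, inv_mul_cancel₀ hq0, one_pow, one_mul]
      rw [sub_eq_zero.mpr, mul_zero, zero_smul]
      exact inv_pow_pred_eq_self hq (by omega)
    obtain ⟨k, hk⟩ : ∃ k, n - 1 = k + 1 := ⟨n - 2, by omega⟩
    rw [hzdef, hk, pow_succ, mul_smul, (gen_a_smul_eq_zero_and hm hn hξ hw h1 h2 u).2, smul_zero]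

theorem gen_a_pow_smul_eq_zero_of_isSimpleModule (hm : 1 < m) (hn : 1 < n)
    (hξ : IsPrimitiveRoot ξ (m * n)) {u : W} (hu : IsWt m n ξ (ξ ^ m)⁻¹ (ξ ^ m) u) :
    ha ^ (n - 1) • u = 0 := by
  have hξ0 : ξ ≠ 0 := hξ.ne_zero (by positivity)
  have hq := isPrimitiveRoot_q hm hn hξ
  have hq0 : ξ ^ m ≠ 0 := pow_ne_zero _ hξ0
  by_contra hw
  obtain ⟨k, hk⟩ : ∃ k, n - 1 = k + 1 := ⟨n - 2, by omega⟩
  set w := ha ^ (n - 1) • u with hwdef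
  have haw : ha • w = 0 := by
    rw [hwdef, ← mul_smul, ← pow_succ', Nat.sub_add_cancel hn.le, hu.a_pow_n_smul, inv_pow,
      hq.pow_eq_one, inv_one, sub_self, zero_smul]
  have hww : IsWt m n ξ 1 1 w := by
    have := hu.a_pow_smul hm hn hξ (n - 1)
    rwa [← pow_succ, ← pow_succ, Nat.sub_add_cancel hn.le, inv_pow, hq.pow_eq_one, inv_one] at this
  have hau : ha • u ≠ 0 := fun h => hw (by rw [hwdef, hk, pow_succ, mul_smul, h, smul_zero])
  have hadw : ha • hd • w = 0 := by
    have := gen_d_smul_a_smul (𝕜 := 𝕜) (m := m) (n := n) (ξ := ξ) w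
    rw [haw, smul_zero, hww.b, hww.c, sub_add_cancel] at this
    exact this.symm
  have hcas : cas 𝕜 m n ξ • u = (ξ ^ m * (ξ ^ m)⁻¹ + ξ ^ m) • u := by
    refine cas_smul_eq_of_isSimpleModule hm hn hξ hw ?_ u
    rw [hww.cas_smul, hadw, smul_zero, zero_add, mul_one, mul_inv_cancel₀ hq0, add_comm]
  have hadu : ha • hd • u = 0 := by
    have := hu.cas_smul
    rw [hcas, right_eq_add, smul_eq_zero] at this
    exact this.resolve_left (one_sub_q_ne_zero hm hn hξ)
  have hgen : IsGen m n ξ (ξ ^ m * (ξ ^ m)⁻¹ + ξ ^ m) u :=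
    ⟨1, by rw [pow_one, sub_smul, hcas, algebraMap_smul, sub_self]⟩
  have hddu : hd • hd • u = 0 := by
    have h1 : hd ^ 2 • u ∈ (⊥ : Submodule (H 𝕜 m n ξ) W) := by
      refine hu.d_pow_smul_mem hm hn hξ ⊥ hgen (show 2 ≤ n by omega) ?_ fun s hs hsn => ?_
      · rw [gen_d_pow, zero_smul]; exact Submodule.zero_mem _
      · rw [Ne, cas_value_eq_iff hq (by omega) hsn, pow_succ, mul_assoc, mul_inv_cancel₀ hq0]
        obtain ⟨t, rfl⟩ : ∃ t, s = t + 1 := ⟨s - 1, by omega⟩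
        rw [mul_one, pow_succ]
        exact pow_mul_ne_self hq hq0 (by omega) (by omega)
    rwa [Submodule.mem_bot, pow_two, mul_smul] at h1
  by_cases hdu : hd • u = 0
  · refine hau (gen_a_smul_eq_zero_and hm hn hξ hw haw ?_ u).1
    rw [hwdef, hk, hu.d_smul_a_pow_smul hm hn hξ, hdu, smul_zero, zero_add, ← pow_succ, ← hk,
      sub_eq_zero.mpr, mul_zero, zero_smul]
    exact (inv_pow_pred_eq_self hq (by omega)).symm
  · exact hau (gen_a_smul_eq_zero_and hm hn hξ hdu hadu hddu u).1

end Simple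

theorem gen_d_pow_mul_specProj_mem_jrad (hm : 1 < m) (hn : 1 < n)
    (hξ : IsPrimitiveRoot ξ (m * n)) :
    hd ^ (n - 1) * (specProj (m * n) (1 : 𝕜) hb * specProj (m * n) (1 : 𝕜) hc) ∈ jrad 𝕜 m n ξ := by
  refine mem_jrad_of_isSimpleModule fun S _ _ _ _ _ u => ?_
  rw [mul_smul, mul_smul]
  refine gen_d_pow_smul_eq_zero_of_isSimpleModule hm hn hξ ?_ ?_
  · rw [gen_b_smul_specProj_smul one_ne_zero (one_pow _), one_smul]
  · rw [gen_c_smul_specProj_smul one_ne_zero (one_pow _), one_smul]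

theorem gen_a_pow_mul_specProj_mem_jrad (hm : 1 < m) (hn : 1 < n)
    (hξ : IsPrimitiveRoot ξ (m * n)) :
    ha ^ (n - 1) * (specProj (m * n) (ξ ^ m)⁻¹ hb * specProj (m * n) (ξ⁻¹ ^ (n - 1)) hc) ∈
      jrad 𝕜 m n ξ := by
  have hξ0 : ξ ≠ 0 := hξ.ne_zero (by positivity)
  have hq := isPrimitiveRoot_q hm hn hξ
  refine mem_jrad_of_isSimpleModule fun S _ _ _ _ _ u => ?_
  rw [mul_smul, mul_smul]
  refine gen_a_pow_smul_eq_zero_of_isSimpleModule hm hn hξ ?_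
  have h1 : (ξ ^ m)⁻¹ ^ (m * n) = 1 := by
    rw [inv_pow, ← pow_mul, mul_comm, pow_mul, hξ.pow_eq_one, one_pow, inv_one]
  have h2 : (ξ⁻¹ ^ (n - 1)) ^ (m * n) = 1 := by
    rw [inv_pow, inv_pow, ← pow_mul, mul_comm, pow_mul, hξ.pow_eq_one, one_pow, inv_one]
  have h3 : (ξ⁻¹ ^ (n - 1)) ^ m = ξ ^ m := by
    rw [← pow_mul, mul_comm, pow_mul, inv_pow, inv_pow_pred_eq_self hq (by omega)]
  have := isWt_of_c_smul
    (gen_b_smul_specProj_smul (inv_ne_zero (pow_ne_zero m hξ0)) h1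
      (specProj (m * n) (ξ⁻¹ ^ (n - 1)) hc • u))
    (gen_c_smul_specProj_smul (pow_ne_zero (n - 1) (inv_ne_zero hξ0)) h2 (ξ ^ m)⁻¹ u)
  rwa [h3] at this

/-! ### A module on which `J ^ 2` acts nontrivially -/

section Linked

variable (𝕜 n) in
/-- The underlying space of the projective cover of the trivial module. -/
abbrev LinkedSpace : Type := (Fin n ⊕ Fin n) →₀ 𝕜

variable (𝕜 n) in
/-- The first half of the standard basis, extended by zero. -/
def linkedU (j : ℕ) : LinkedSpace 𝕜 n :=
  if h : j < n then Finsupp.single (Sum.inl ⟨j, h⟩) 1 else 0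

variable (𝕜 n) in
/-- The second half of the standard basis, extended by zero. -/
def linkedV (j : ℕ) : LinkedSpace 𝕜 n :=
  if h : j < n then Finsupp.single (Sum.inr ⟨j, h⟩) 1 else 0

/-- The endomorphism with prescribed values on the standard basis. -/
def linkedEnd (f g : ℕ → LinkedSpace 𝕜 n) : Module.End 𝕜 (LinkedSpace 𝕜 n) :=
  Finsupp.linearCombination 𝕜 (Sum.elim (fun j => f j) fun j => g j)

theorem linkedEnd_linkedU (f g : ℕ → LinkedSpace 𝕜 n) {j : ℕ} (hj : j < n) :
    linkedEnd f g (linkedU 𝕜 n j) = f j := by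
  simp [linkedEnd, linkedU, hj]

theorem linkedEnd_linkedV (f g : ℕ → LinkedSpace 𝕜 n) {j : ℕ} (hj : j < n) :
    linkedEnd f g (linkedV 𝕜 n j) = g j := by
  simp [linkedEnd, linkedV, hj]

theorem linkedU_eq_zero {j : ℕ} (hj : n ≤ j) : linkedU 𝕜 n j = 0 := dif_neg (by omega)

theorem linkedV_eq_zero {j : ℕ} (hj : n ≤ j) : linkedV 𝕜 n j = 0 := dif_neg (by omega)

theorem linkedU_ne_zero {j : ℕ} (hj : j < n) : linkedU 𝕜 n j ≠ 0 := by
  rw [linkedU, dif_pos hj]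
  exact Finsupp.single_ne_zero.mpr one_ne_zero

theorem linkedEnd_ext {f g : Module.End 𝕜 (LinkedSpace 𝕜 n)}
    (hu : ∀ j < n, f (linkedU 𝕜 n j) = g (linkedU 𝕜 n j))
    (hv : ∀ j < n, f (linkedV 𝕜 n j) = g (linkedV 𝕜 n j)) : f = g := by
  refine Finsupp.lhom_ext' fun k => LinearMap.ext_ring ?_
  rcases k with ⟨j, hj⟩ | ⟨j, hj⟩
  · simpa [linkedU, hj] using hu j hj
  · simpa [linkedV, hj] using hv j hj

/-- The coefficients of the action of `a`. -/
def linkedCoeff (q : 𝕜) (k : ℕ) : 𝕜 := (q ^ (k + 1) + q⁻¹ ^ k - 1 - q) / (q - 1)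

variable (𝕜 n) in
/-- The action of `a`. -/
def linkedA (q : 𝕜) : Module.End 𝕜 (LinkedSpace 𝕜 n) :=
  linkedEnd
    (fun j => linkedCoeff q j • linkedU 𝕜 n (j + 1) +
      if j + 1 = n then ((q - 1) / qFact 𝕜 q (n - 1)) • linkedU 𝕜 n 0 else 0)
    (fun j => linkedCoeff q (j + 1) • linkedV 𝕜 n (j + 1) +
      if j + 2 = n then linkedU 𝕜 n 0 else
      if j + 1 = n then linkedU 𝕜 n 1 - ((q - 1) / qFact 𝕜 q (n - 1)) • linkedV 𝕜 n 0 else 0)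

variable (𝕜 n) in
/-- The action of `b`. -/
def linkedB (q : 𝕜) : Module.End 𝕜 (LinkedSpace 𝕜 n) :=
  linkedEnd (fun j => q⁻¹ ^ j • linkedU 𝕜 n j) (fun j => q⁻¹ ^ (j + 1) • linkedV 𝕜 n j)

variable (𝕜 n) in
/-- The action of `c`. -/
def linkedC (ξ : 𝕜) : Module.End 𝕜 (LinkedSpace 𝕜 n) :=
  linkedEnd (fun j => ξ ^ j • linkedU 𝕜 n j) (fun j => (ξ⁻¹ ^ (n - 1) * ξ ^ j) • linkedV 𝕜 n j)

variable (𝕜 n) in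
/-- The action of `d`. -/
def linkedD : Module.End 𝕜 (LinkedSpace 𝕜 n) :=
  linkedEnd (fun j => if j = 0 then 0 else linkedU 𝕜 n (j - 1))
    (fun j => if j = 0 then 0 else linkedV 𝕜 n (j - 1))

theorem linkedCoeff_zero (q : 𝕜) : linkedCoeff q 0 = 0 := by simp [linkedCoeff]

theorem linkedCoeff_pred {q : 𝕜} (hq : IsPrimitiveRoot q n) (hn : 0 < n) :
    linkedCoeff q (n - 1) = 0 := by
  rw [linkedCoeff, inv_pow_pred_eq_self hq hn, Nat.sub_add_cancel hn, hq.pow_eq_one]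
  simp

theorem linkedCoeff_sub_succ {q : 𝕜} (hq : IsPrimitiveRoot q n) (hn : 1 < n) (k : ℕ) :
    linkedCoeff q k - linkedCoeff q (k + 1) = q⁻¹ ^ (k + 1) - q ^ (k + 1) := by
  have hq0 : q ≠ 0 := hq.ne_zero (by omega)
  have hq1 : q - 1 ≠ 0 := sub_ne_zero.mpr (hq.ne_one hn)
  simp only [linkedCoeff, inv_pow]
  field_simp
  ring

theorem linkedCoeff_ne_zero {q : 𝕜} (hq : IsPrimitiveRoot q n) {k : ℕ} (hk : 0 < k)
    (hkn : k + 1 < n) : linkedCoeff q k ≠ 0 := by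
  have hq0 : q ≠ 0 := hq.ne_zero (by omega)
  have hq1 : q - 1 ≠ 0 := sub_ne_zero.mpr (hq.ne_one (by omega))
  have h1 : q ^ k - 1 ≠ 0 := sub_ne_zero.mpr (hq.pow_ne_one_of_pos_of_lt hk.ne' (by omega))
  have h2 : q ^ (k + 1) - 1 ≠ 0 :=
    sub_ne_zero.mpr (hq.pow_ne_one_of_pos_of_lt (by omega) hkn)
  have h3 : linkedCoeff q k = (q ^ k - 1) * (q ^ (k + 1) - 1) / (q ^ k * (q - 1)) := by
    simp only [linkedCoeff, inv_pow]
    field_simp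
    ring
  rw [h3]
  exact div_ne_zero (mul_ne_zero h1 h2) (mul_ne_zero (pow_ne_zero _ hq0) hq1)

theorem qFact_ne_zero {q : 𝕜} (hq : IsPrimitiveRoot q n) {k : ℕ} (hk : k < n) :
    qFact 𝕜 q k ≠ 0 := by
  induction k with
  | zero => exact one_ne_zero
  | succ k ih => exact mul_ne_zero (ih (by omega)) (qInt_ne_zero hq k.succ_pos hk)

theorem linkedA_linkedU {q : 𝕜} {j : ℕ} (hj : j + 1 < n) :
    linkedA 𝕜 n q (linkedU 𝕜 n j) = linkedCoeff q j • linkedU 𝕜 n (j + 1) := by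
  rw [linkedA, linkedEnd_linkedU _ _ (by omega), if_neg (by omega), add_zero]

theorem linkedA_linkedU_last {q : 𝕜} {j : ℕ} (hj : j + 1 = n) :
    linkedA 𝕜 n q (linkedU 𝕜 n j) = ((q - 1) / qFact 𝕜 q (n - 1)) • linkedU 𝕜 n 0 := by
  rw [linkedA, linkedEnd_linkedU _ _ (by omega), if_pos hj, linkedU_eq_zero hj.ge, smul_zero,
    zero_add]

theorem linkedA_linkedV {q : 𝕜} {j : ℕ} (hj : j + 2 < n) :
    linkedA 𝕜 n q (linkedV 𝕜 n j) = linkedCoeff q (j + 1) • linkedV 𝕜 n (j + 1) := by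
  rw [linkedA, linkedEnd_linkedV _ _ (by omega), if_neg (by omega), if_neg (by omega), add_zero]

theorem linkedA_linkedV_penultimate {q : 𝕜} (hq : IsPrimitiveRoot q n) {j : ℕ} (hj : j + 2 = n) :
    linkedA 𝕜 n q (linkedV 𝕜 n j) = linkedU 𝕜 n 0 := by
  have := linkedCoeff_pred hq (by omega)
  rw [linkedA, linkedEnd_linkedV _ _ (by omega), if_pos hj, show j + 1 = n - 1 by omega, this,
    zero_smul, zero_add]

theorem linkedA_linkedV_last {q : 𝕜} {j : ℕ} (hj : j + 1 = n) :
    linkedA 𝕜 n q (linkedV 𝕜 n j) =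
      linkedU 𝕜 n 1 - ((q - 1) / qFact 𝕜 q (n - 1)) • linkedV 𝕜 n 0 := by
  rw [linkedA, linkedEnd_linkedV _ _ (by omega), if_neg (by omega), if_pos hj,
    linkedV_eq_zero hj.ge, smul_zero, zero_add]

theorem linkedB_linkedU (q : 𝕜) (j : ℕ) :
    linkedB 𝕜 n q (linkedU 𝕜 n j) = q⁻¹ ^ j • linkedU 𝕜 n j := by
  rcases Nat.lt_or_ge j n with hj | hj
  · rw [linkedB, linkedEnd_linkedU _ _ hj]
  · rw [linkedU_eq_zero hj, map_zero, smul_zero]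

theorem linkedB_linkedV (q : 𝕜) (j : ℕ) :
    linkedB 𝕜 n q (linkedV 𝕜 n j) = q⁻¹ ^ (j + 1) • linkedV 𝕜 n j := by
  rcases Nat.lt_or_ge j n with hj | hj
  · rw [linkedB, linkedEnd_linkedV _ _ hj]
  · rw [linkedV_eq_zero hj, map_zero, smul_zero]

theorem linkedC_linkedU (ξ : 𝕜) (j : ℕ) :
    linkedC 𝕜 n ξ (linkedU 𝕜 n j) = ξ ^ j • linkedU 𝕜 n j := by
  rcases Nat.lt_or_ge j n with hj | hj
  · rw [linkedC, linkedEnd_linkedU _ _ hj]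
  · rw [linkedU_eq_zero hj, map_zero, smul_zero]

theorem linkedC_linkedV (ξ : 𝕜) (j : ℕ) :
    linkedC 𝕜 n ξ (linkedV 𝕜 n j) = (ξ⁻¹ ^ (n - 1) * ξ ^ j) • linkedV 𝕜 n j := by
  rcases Nat.lt_or_ge j n with hj | hj
  · rw [linkedC, linkedEnd_linkedV _ _ hj]
  · rw [linkedV_eq_zero hj, map_zero, smul_zero]

theorem linkedD_linkedU_zero : linkedD 𝕜 n (linkedU 𝕜 n 0) = 0 := by
  rcases Nat.eq_zero_or_pos n with rfl | hn
  · rw [linkedU_eq_zero le_rfl, map_zero]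
  · rw [linkedD, linkedEnd_linkedU _ _ hn, if_pos rfl]

theorem linkedD_linkedV_zero : linkedD 𝕜 n (linkedV 𝕜 n 0) = 0 := by
  rcases Nat.eq_zero_or_pos n with rfl | hn
  · rw [linkedV_eq_zero le_rfl, map_zero]
  · rw [linkedD, linkedEnd_linkedV _ _ hn, if_pos rfl]

theorem linkedD_linkedU_succ {j : ℕ} (hj : j + 1 < n) :
    linkedD 𝕜 n (linkedU 𝕜 n (j + 1)) = linkedU 𝕜 n j := by
  rw [linkedD, linkedEnd_linkedU _ _ hj, if_neg (by omega), Nat.add_sub_cancel]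

theorem linkedD_linkedV_succ {j : ℕ} (hj : j + 1 < n) :
    linkedD 𝕜 n (linkedV 𝕜 n (j + 1)) = linkedV 𝕜 n j := by
  rw [linkedD, linkedEnd_linkedV _ _ hj, if_neg (by omega), Nat.add_sub_cancel]

theorem end_pow_apply_eq {V : Type*} [AddCommGroup V] [Module 𝕜 V] {f : Module.End 𝕜 V} {r : 𝕜}
    {x : V} (h : f x = r • x) (k : ℕ) : (f ^ k) x = r ^ k • x := by
  induction k with
  | zero => simp
  | succ k ih => rw [pow_succ', Module.End.mul_apply, ih, map_smul, h, smul_smul, pow_succ]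

theorem linkedD_pow_linkedU {j k : ℕ} (hj : j < n) :
    (linkedD 𝕜 n ^ k) (linkedU 𝕜 n j) = if k ≤ j then linkedU 𝕜 n (j - k) else 0 := by
  induction k generalizing j with
  | zero => simp
  | succ k ih =>
    rw [pow_succ, Module.End.mul_apply]
    cases j with
    | zero => rw [linkedD_linkedU_zero, map_zero, if_neg (by omega)]
    | succ j => rw [linkedD_linkedU_succ hj, ih (by omega)]; simp

theorem linkedD_pow_linkedV {j k : ℕ} (hj : j < n) :
    (linkedD 𝕜 n ^ k) (linkedV 𝕜 n j) = if k ≤ j then linkedV 𝕜 n (j - k) else 0 := by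
  induction k generalizing j with
  | zero => simp
  | succ k ih =>
    rw [pow_succ, Module.End.mul_apply]
    cases j with
    | zero => rw [linkedD_linkedV_zero, map_zero, if_neg (by omega)]
    | succ j => rw [linkedD_linkedV_succ hj, ih (by omega)]; simp

theorem linkedA_pow_linkedU {q : 𝕜} {j k : ℕ} (hj : j + k < n) :
    (linkedA 𝕜 n q ^ k) (linkedU 𝕜 n j) =
      (∏ i ∈ Finset.range k, linkedCoeff q (j + i)) • linkedU 𝕜 n (j + k) := by
  induction k with
  | zero => simp
  | succ k ih =>
    rw [pow_succ', Module.End.mul_apply, ih (by omega), map_smul, linkedA_linkedU (by omega),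
      smul_smul, Finset.prod_range_succ]
    rfl

theorem linkedA_pow_linkedV {q : 𝕜} {j k : ℕ} (hj : j + k + 1 < n) :
    (linkedA 𝕜 n q ^ k) (linkedV 𝕜 n j) =
      (∏ i ∈ Finset.range k, linkedCoeff q (j + 1 + i)) • linkedV 𝕜 n (j + k) := by
  induction k with
  | zero => simp
  | succ k ih =>
    rw [pow_succ', Module.End.mul_apply, ih (by omega), map_smul, linkedA_linkedV (by omega),
      smul_smul, Finset.prod_range_succ, add_right_comm j 1 k]
    rfl

theorem linkedA_linkedU_zero {q : 𝕜} (hn : 1 < n) : linkedA 𝕜 n q (linkedU 𝕜 n 0) = 0 := by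
  rw [linkedA_linkedU hn, linkedCoeff_zero, zero_smul]

theorem linkedA_pow_pred_linkedV_zero {q : 𝕜} (hq : IsPrimitiveRoot q n) (hn : 1 < n) :
    (linkedA 𝕜 n q ^ (n - 1)) (linkedV 𝕜 n 0) =
      (∏ i ∈ Finset.range (n - 2), linkedCoeff q (1 + i)) • linkedU 𝕜 n 0 := by
  rw [show n - 1 = n - 2 + 1 by omega, pow_succ', Module.End.mul_apply,
    linkedA_pow_linkedV (by omega), map_smul, linkedA_linkedV_penultimate hq (by omega), zero_add]

theorem linkedA_pow_eq_zero {q : 𝕜} (hq : IsPrimitiveRoot q n) (hn : 1 < n) :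
    linkedA 𝕜 n q ^ n = 0 := by
  refine linkedEnd_ext (fun j hj => ?_) fun j hj => ?_
  · rw [LinearMap.zero_apply]
    rcases Nat.eq_zero_or_pos j with rfl | hj0
    · rw [← Nat.sub_add_cancel hn.le, pow_succ, Module.End.mul_apply, Nat.sub_add_cancel hn.le,
        linkedA_linkedU_zero hn, map_zero]
    · rw [show n = j - 1 + 1 + 1 + (n - 1 - j) by omega, pow_add, pow_succ, pow_succ,
        Module.End.mul_apply, Module.End.mul_apply, Module.End.mul_apply,
        show j - 1 + 1 + 1 + (n - 1 - j) = n by omega,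
        linkedA_pow_linkedU (by omega), map_smul, linkedA_linkedU_last (by omega), map_smul,
        map_smul, map_smul, linkedA_linkedU_zero hn]
      simp
  · rw [LinearMap.zero_apply]
    rcases Nat.lt_or_ge (j + 1) n with hj1 | hj1
    · rw [show n = j + 1 + 1 + (n - 2 - j) by omega, pow_add, pow_succ, pow_succ,
        Module.End.mul_apply, Module.End.mul_apply, Module.End.mul_apply,
        show j + 1 + 1 + (n - 2 - j) = n by omega,
        linkedA_pow_linkedV (by omega), map_smul, linkedA_linkedV_penultimate hq (by omega),
        map_smul, linkedA_linkedU_zero hn]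
      simp
    · have h1 : (linkedA 𝕜 n q ^ (n - 1)) (linkedU 𝕜 n 1) =
          (∏ i ∈ Finset.range (n - 2), linkedCoeff q (1 + i)) •
            ((q - 1) / qFact 𝕜 q (n - 1)) • linkedU 𝕜 n 0 := by
        rw [show n - 1 = n - 2 + 1 by omega, pow_succ', Module.End.mul_apply,
          linkedA_pow_linkedU (by omega), map_smul, linkedA_linkedU_last (by omega),
          show n - 2 + 1 = n - 1 by omega]
      have h2 : linkedA 𝕜 n q ^ n = linkedA 𝕜 n q ^ (n - 1) * linkedA 𝕜 n q := by
        rw [← pow_succ, Nat.sub_add_cancel hn.le]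
      rw [h2, Module.End.mul_apply, linkedA_linkedV_last (by omega), map_sub, map_smul, h1,
        linkedA_pow_pred_linkedV_zero hq hn, smul_comm, sub_self]

theorem linkedA_mul_linkedB {q : 𝕜} (hq : IsPrimitiveRoot q n) (hn : 1 < n) :
    linkedA 𝕜 n q * linkedB 𝕜 n q = q • (linkedB 𝕜 n q * linkedA 𝕜 n q) := by
  have hq0 : q ≠ 0 := hq.ne_zero (by omega)
  refine linkedEnd_ext (fun j hj => ?_) fun j hj => ?_ <;>
    simp only [Module.End.mul_apply, LinearMap.smul_apply, linkedB_linkedU, linkedB_linkedV,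
      map_smul]
  · rcases Nat.lt_or_ge (j + 1) n with h | h
    · rw [linkedA_linkedU h, map_smul, linkedB_linkedU, pow_succ]
      match_scalars
      field_simp
    · rw [linkedA_linkedU_last (by omega), map_smul, linkedB_linkedU, show j = n - 1 by omega,
        inv_pow_pred_eq_self hq (by omega)]
      match_scalars
      ring
  · rcases Nat.lt_or_ge (j + 2) n with h | h
    · rw [linkedA_linkedV h, map_smul, linkedB_linkedV, pow_succ _ (j + 1)]
      match_scalars
      field_simp
    · rcases Nat.lt_or_ge (j + 1) n with h' | h'
      · rw [linkedA_linkedV_penultimate hq (by omega), linkedB_linkedU, show j + 1 = n - 1 by omega,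
          inv_pow_pred_eq_self hq (by omega)]
        match_scalars
        ring
      · rw [linkedA_linkedV_last (by omega), map_sub, map_smul, linkedB_linkedU, linkedB_linkedV,
          show j + 1 = n by omega, inv_pow q n, hq.pow_eq_one, zero_add, pow_one]
        match_scalars <;> field_simp

theorem linkedD_mul_linkedC {ξ : 𝕜} :
    linkedD 𝕜 n * linkedC 𝕜 n ξ = ξ • (linkedC 𝕜 n ξ * linkedD 𝕜 n) := by
  refine linkedEnd_ext (fun j hj => ?_) fun j hj => ?_ <;>
    simp only [Module.End.mul_apply, LinearMap.smul_apply, linkedC_linkedU, linkedC_linkedV,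
      map_smul]
  · cases j with
    | zero => rw [linkedD_linkedU_zero, map_zero, smul_zero, smul_zero]
    | succ j =>
      rw [linkedD_linkedU_succ hj, linkedC_linkedU]
      match_scalars
      ring
  · cases j with
    | zero => rw [linkedD_linkedV_zero, map_zero, smul_zero, smul_zero]
    | succ j =>
      rw [linkedD_linkedV_succ hj, linkedC_linkedV]
      match_scalars
      ring

theorem linkedB_mul_linkedC {q ξ : 𝕜} :
    linkedB 𝕜 n q * linkedC 𝕜 n ξ = linkedC 𝕜 n ξ * linkedB 𝕜 n q := by
  refine linkedEnd_ext (fun j hj => ?_) fun j hj => ?_ <;>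
    simp only [Module.End.mul_apply, linkedB_linkedU, linkedB_linkedV, linkedC_linkedU,
      linkedC_linkedV, map_smul, smul_smul, mul_comm]

theorem linkedB_mul_linkedD {q : 𝕜} (hq0 : q ≠ 0) :
    linkedB 𝕜 n q * linkedD 𝕜 n = q • (linkedD 𝕜 n * linkedB 𝕜 n q) := by
  refine linkedEnd_ext (fun j hj => ?_) fun j hj => ?_ <;>
    simp only [Module.End.mul_apply, LinearMap.smul_apply, linkedB_linkedU, linkedB_linkedV,
      map_smul]
  · cases j with
    | zero => rw [linkedD_linkedU_zero, map_zero, smul_zero, smul_zero]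
    | succ j =>
      rw [linkedD_linkedU_succ hj, linkedB_linkedU, pow_succ]
      match_scalars
      field_simp
  · cases j with
    | zero => rw [linkedD_linkedV_zero, map_zero, smul_zero, smul_zero]
    | succ j =>
      rw [linkedD_linkedV_succ hj, linkedB_linkedV, pow_succ _ (j + 1)]
      match_scalars
      field_simp

theorem linkedC_pow_linkedU (ξ : 𝕜) (m j : ℕ) :
    (linkedC 𝕜 n ξ ^ m) (linkedU 𝕜 n j) = (ξ ^ m) ^ j • linkedU 𝕜 n j := by
  rw [end_pow_apply_eq (linkedC_linkedU ξ j), pow_right_comm]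

theorem linkedC_pow_linkedV {ξ : 𝕜} (hq : IsPrimitiveRoot (ξ ^ m) n) (hn : 0 < n) (j : ℕ) :
    (linkedC 𝕜 n ξ ^ m) (linkedV 𝕜 n j) = (ξ ^ m) ^ (j + 1) • linkedV 𝕜 n j := by
  rw [end_pow_apply_eq (linkedC_linkedV ξ j), mul_pow, pow_right_comm, inv_pow,
    inv_pow_pred_eq_self hq hn, pow_right_comm, ← pow_succ']

theorem linkedA_mul_linkedD {ξ : 𝕜} (hq : IsPrimitiveRoot (ξ ^ m) n) (hn : 1 < n) :
    linkedA 𝕜 n (ξ ^ m) * linkedD 𝕜 n - linkedD 𝕜 n * linkedA 𝕜 n (ξ ^ m) =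
      linkedB 𝕜 n (ξ ^ m) - linkedC 𝕜 n ξ ^ m := by
  have hg := linkedCoeff_sub_succ hq hn
  refine linkedEnd_ext (fun j hj => ?_) fun j hj => ?_ <;>
    simp only [Module.End.mul_apply, LinearMap.sub_apply, linkedB_linkedU, linkedB_linkedV,
      linkedC_pow_linkedU, linkedC_pow_linkedV hq (by omega)] <;>
    rw [← sub_smul]
  · have hD : linkedD 𝕜 n (linkedA 𝕜 n (ξ ^ m) (linkedU 𝕜 n j)) =
        linkedCoeff (ξ ^ m) j • linkedU 𝕜 n j := by
      rcases Nat.lt_or_ge (j + 1) n with h | h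
      · rw [linkedA_linkedU h, map_smul, linkedD_linkedU_succ h]
      · rw [linkedA_linkedU_last (by omega), map_smul, linkedD_linkedU_zero,
          show j = n - 1 by omega, linkedCoeff_pred hq (by omega), smul_zero, zero_smul]
    rw [hD]
    cases j with
    | zero => simp [linkedD_linkedU_zero, linkedCoeff_zero]
    | succ j => rw [linkedD_linkedU_succ hj, linkedA_linkedU hj, ← sub_smul, hg]
  · rw [← hg, sub_smul]
    rcases Nat.lt_or_ge (j + 1) n with h | h
    · have hD : linkedD 𝕜 n (linkedA 𝕜 n (ξ ^ m) (linkedV 𝕜 n j)) =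
          linkedCoeff (ξ ^ m) (j + 1) • linkedV 𝕜 n j := by
        rcases Nat.lt_or_ge (j + 2) n with h' | h'
        · rw [linkedA_linkedV h', map_smul, linkedD_linkedV_succ h]
        · rw [linkedA_linkedV_penultimate hq (by omega), linkedD_linkedU_zero,
            show j + 1 = n - 1 by omega, linkedCoeff_pred hq (by omega), zero_smul]
      rw [hD]
      cases j with
      | zero => simp [linkedD_linkedV_zero, linkedCoeff_zero]
      | succ j => rw [linkedD_linkedV_succ hj, linkedA_linkedV h]
    · obtain ⟨j, rfl⟩ : ∃ k, j = k + 1 := ⟨j - 1, by omega⟩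
      rw [linkedD_linkedV_succ hj, linkedA_linkedV_penultimate hq (by omega),
        linkedA_linkedV_last (by omega), map_sub, map_smul, linkedD_linkedV_zero, smul_zero,
        sub_zero, linkedD_linkedU_succ hn, sub_self, ← sub_smul, hg, show j + 1 + 1 = n by omega,
        inv_pow, hq.pow_eq_one, inv_one, sub_self, zero_smul]

theorem linkedA_mul_linkedC {ξ : 𝕜} (hξ0 : ξ ≠ 0) (hq : IsPrimitiveRoot (ξ ^ m) n) (hn : 1 < n) :
    linkedA 𝕜 n (ξ ^ m) * linkedC 𝕜 n ξ = ξ⁻¹ • (linkedC 𝕜 n ξ * linkedA 𝕜 n (ξ ^ m)) +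
      ((ξ⁻¹ - ξ ^ (n - 1)) / qFact 𝕜 (ξ ^ m) (n - 1)) •
        ((linkedC 𝕜 n ξ ^ (m + 1) - ξ ^ m • (linkedB 𝕜 n (ξ ^ m) * linkedC 𝕜 n ξ)) *
          linkedD 𝕜 n ^ (n - 1)) := by
  have hF := qFact_ne_zero hq (show n - 1 < n by omega)
  have hξn : ξ ^ (n - 1) ≠ 0 := pow_ne_zero _ hξ0
  refine linkedEnd_ext (fun j hj => ?_) fun j hj => ?_ <;>
    simp only [Module.End.mul_apply, LinearMap.smul_apply, LinearMap.add_apply,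
      LinearMap.sub_apply, linkedC_linkedU, linkedC_linkedV, map_smul, pow_succ (linkedC 𝕜 n ξ)]
  · rw [linkedD_pow_linkedU hj]
    rcases Nat.lt_or_ge (j + 1) n with h | h
    · rw [if_neg (by omega), linkedA_linkedU h, map_smul, linkedC_linkedU]
      simp only [map_zero, smul_zero, sub_zero, add_zero, pow_succ]
      match_scalars
      field_simp
    · rw [if_pos (by omega), show j = n - 1 by omega, linkedA_linkedU_last (by omega), Nat.sub_self]
      simp only [map_smul, linkedC_linkedU, linkedB_linkedU, linkedC_pow_linkedU, pow_zero]
      match_scalars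
      field_simp
      ring
  · rw [linkedD_pow_linkedV hj]
    rcases Nat.lt_or_ge (j + 1) n with h | h
    · rw [if_neg (by omega)]
      simp only [map_zero, smul_zero, sub_zero, add_zero]
      rcases Nat.lt_or_ge (j + 2) n with h' | h'
      · rw [linkedA_linkedV h', map_smul, linkedC_linkedV, pow_succ]
        match_scalars
        field_simp
      · rw [linkedA_linkedV_penultimate hq (by omega), linkedC_linkedU,
          show n - 1 = j + 1 by omega, pow_succ, inv_pow]
        match_scalars
        field_simp
    · rw [if_pos (by omega), show j = n - 1 by omega, linkedA_linkedV_last (by omega), Nat.sub_self]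
      simp only [map_smul, map_sub, linkedC_linkedU, linkedC_linkedV, linkedB_linkedV,
        linkedC_pow_linkedV hq (show 0 < n by omega), pow_zero, zero_add, pow_one, inv_pow]
      have hq0 : ξ ^ m ≠ 0 := pow_ne_zero _ hξ0
      match_scalars
      · field_simp
      · field_simp
        ring

theorem linkedB_pow_eq_one {q : 𝕜} {N : ℕ} (hq : q ^ N = 1) : linkedB 𝕜 n q ^ N = 1 := by
  refine linkedEnd_ext (fun j hj => ?_) fun j hj => ?_
  · rw [end_pow_apply_eq (linkedB_linkedU q j), pow_right_comm, inv_pow, hq, inv_one, one_pow,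
      one_smul, Module.End.one_apply]
  · rw [end_pow_apply_eq (linkedB_linkedV q j), pow_right_comm, inv_pow, hq, inv_one, one_pow,
      one_smul, Module.End.one_apply]

theorem linkedC_pow_eq_one {ξ : 𝕜} {N : ℕ} (hξ : ξ ^ N = 1) : linkedC 𝕜 n ξ ^ N = 1 := by
  refine linkedEnd_ext (fun j hj => ?_) fun j hj => ?_
  · rw [linkedC_pow_linkedU, hξ, one_pow, one_smul, Module.End.one_apply]
  · rw [end_pow_apply_eq (linkedC_linkedV ξ j), mul_pow, pow_right_comm, inv_pow, hξ,
      pow_right_comm, hξ, inv_one, one_pow, one_pow, one_mul, one_smul, Module.End.one_apply]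

theorem linkedD_pow_eq_zero : linkedD 𝕜 n ^ n = 0 := by
  refine linkedEnd_ext (fun j hj => ?_) fun j hj => ?_
  · rw [linkedD_pow_linkedU hj, if_neg (by omega), LinearMap.zero_apply]
  · rw [linkedD_pow_linkedV hj, if_neg (by omega), LinearMap.zero_apply]

variable (𝕜 m n ξ) in
/-- The action of the generators. -/
def linkedGen : FreeAlgebra 𝕜 (Fin 4) →ₐ[𝕜] Module.End 𝕜 (LinkedSpace 𝕜 n) :=
  FreeAlgebra.lift 𝕜
    ![linkedA 𝕜 n (ξ ^ m), linkedB 𝕜 n (ξ ^ m), linkedC 𝕜 n ξ, linkedD 𝕜 n]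

theorem linkedGen_fgen (k : Fin 4) : linkedGen 𝕜 m n ξ (fgen 𝕜 k) =
    ![linkedA 𝕜 n (ξ ^ m), linkedB 𝕜 n (ξ ^ m), linkedC 𝕜 n ξ, linkedD 𝕜 n] k :=
  FreeAlgebra.lift_ι_apply _ _

theorem linkedGen_rel (hm : 1 < m) (hn : 1 < n) (hξ : IsPrimitiveRoot ξ (m * n))
    ⦃x y : FreeAlgebra 𝕜 (Fin 4)⦄ (h : HRel 𝕜 m n ξ x y) :
    linkedGen 𝕜 m n ξ x = linkedGen 𝕜 m n ξ y := by
  have hq := isPrimitiveRoot_q hm hn hξ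
  have hξ0 : ξ ≠ 0 := hξ.ne_zero (by positivity)
  have h0 := linkedGen_fgen (𝕜 := 𝕜) (m := m) (n := n) (ξ := ξ) 0
  have h1 := linkedGen_fgen (𝕜 := 𝕜) (m := m) (n := n) (ξ := ξ) 1
  have h2 := linkedGen_fgen (𝕜 := 𝕜) (m := m) (n := n) (ξ := ξ) 2
  have h3 := linkedGen_fgen (𝕜 := 𝕜) (m := m) (n := n) (ξ := ξ) 3
  simp only [Matrix.cons_val] at h0 h1 h2 h3
  cases h <;>
    simp only [map_mul, map_smul, map_add, map_sub, map_pow, map_one, map_zero, h0, h1, h2, h3]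
  · rw [linkedA_pow_eq_zero hq hn, linkedB_pow_eq_one hq.pow_eq_one, sub_self]
  · refine linkedB_pow_eq_one ?_
    rw [← pow_mul, mul_comm, pow_mul, hξ.pow_eq_one, one_pow]
  · exact linkedC_pow_eq_one hξ.pow_eq_one
  · exact linkedD_pow_eq_zero
  · exact linkedA_mul_linkedB hq hn
  · exact linkedD_mul_linkedC
  · exact linkedB_mul_linkedC
  · exact linkedB_mul_linkedD (pow_ne_zero _ hξ0)
  · exact linkedA_mul_linkedD hq hn
  · exact linkedA_mul_linkedC hξ0 hq hn

theorem exists_linkedRep (hm : 1 < m) (hn : 1 < n) (hξ : IsPrimitiveRoot ξ (m * n)) :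
    ∃ ρ : H 𝕜 m n ξ →ₐ[𝕜] Module.End 𝕜 (LinkedSpace 𝕜 n),
      ρ ha = linkedA 𝕜 n (ξ ^ m) ∧ ρ hb = linkedB 𝕜 n (ξ ^ m) ∧ ρ hc = linkedC 𝕜 n ξ ∧
        ρ hd = linkedD 𝕜 n := by
  let ρ : H 𝕜 m n ξ →ₐ[𝕜] Module.End 𝕜 (LinkedSpace 𝕜 n) :=
    RingQuot.liftAlgHom 𝕜 ⟨linkedGen 𝕜 m n ξ, linkedGen_rel hm hn hξ⟩
  have hρ : ∀ k, ρ (gen 𝕜 m n ξ k) = linkedGen 𝕜 m n ξ (fgen 𝕜 k) := fun k =>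
    RingQuot.liftAlgHom_mkAlgHom_apply 𝕜 _ _ _
  exact ⟨ρ, by rw [hρ, linkedGen_fgen]; rfl, by rw [hρ, linkedGen_fgen]; rfl,
    by rw [hρ, linkedGen_fgen]; rfl, by rw [hρ, linkedGen_fgen]; rfl⟩

end Linked

theorem gen_a_pow_mul_gen_d_pow_ne_zero (hm : 1 < m) (hn : 1 < n)
    (hξ : IsPrimitiveRoot ξ (m * n)) :
    ha ^ (n - 1) * (specProj (m * n) (ξ ^ m)⁻¹ hb * specProj (m * n) (ξ⁻¹ ^ (n - 1)) hc) *
      (hd ^ (n - 1) * (specProj (m * n) (1 : 𝕜) hb * specProj (m * n) (1 : 𝕜) hc)) ≠ 0 := by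
  have hq := isPrimitiveRoot_q hm hn hξ
  have hξ0 : ξ ≠ 0 := hξ.ne_zero (by positivity)
  have : NeZero (m * n) := ⟨by positivity⟩
  have hN : ((m * n : ℕ) : 𝕜) ≠ 0 := hξ.neZero'.out
  obtain ⟨ρ, hρa, hρb, hρc, hρd⟩ := exists_linkedRep hm hn hξ
  have hρs : ∀ (N : ℕ) (ζ : 𝕜) (t : H 𝕜 m n ξ), ρ (specProj N ζ t) = specProj N ζ (ρ t) :=
    fun N ζ t => by simp only [specProj, map_smul, map_sum, map_pow]
  intro h0
  have h1 := congrArg (fun x => ρ x (linkedV 𝕜 n (n - 1))) h0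
  simp only [map_mul, map_pow, hρs, map_zero, hρa, hρb, hρc, hρd, Module.End.mul_apply,
    LinearMap.zero_apply] at h1
  have hp : ∀ {ζ : 𝕜} {t : Module.End 𝕜 (LinkedSpace 𝕜 n)} {x : LinkedSpace 𝕜 n}, ζ ≠ 0 →
      t x = ζ • x → specProj (m * n) ζ t x = x := fun {ζ t x} hζ hx =>
    specProj_smul (t := t) (x := x) hN hζ hx
  have hc1 := linkedC_linkedV (𝕜 := 𝕜) (n := n) ξ (n - 1)
  have hb1 := linkedB_linkedV (𝕜 := 𝕜) (n := n) (ξ ^ m) (n - 1)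
  have hc0 := linkedC_linkedV (𝕜 := 𝕜) (n := n) ξ 0
  have hb0 := linkedB_linkedV (𝕜 := 𝕜) (n := n) (ξ ^ m) 0
  rw [← mul_pow, inv_mul_cancel₀ hξ0, one_pow] at hc1
  rw [Nat.sub_add_cancel hn.le, inv_pow, hq.pow_eq_one, inv_one] at hb1
  rw [pow_zero, mul_one] at hc0
  rw [zero_add, pow_one] at hb0
  rw [hp one_ne_zero hc1, hp one_ne_zero hb1, linkedD_pow_linkedV (by omega), if_pos le_rfl,
    Nat.sub_self, hp (pow_ne_zero _ (inv_ne_zero hξ0)) hc0,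
    hp (inv_ne_zero (pow_ne_zero _ hξ0)) hb0, linkedA_pow_pred_linkedV_zero hq hn] at h1
  refine smul_ne_zero (Finset.prod_ne_zero_iff.mpr fun i hi => ?_) (linkedU_ne_zero (by omega)) h1
  rw [Finset.mem_range] at hi
  exact linkedCoeff_ne_zero hq (by omega) (by omega)

end

/-- Lemma 3.5(1),(3): for `(i,j) ∈ I_0` the module `Z(λ_{ij})` is projective,
and the Loewy length of `H_{mn}(ξ)` is 3, i.e. `J³ = 0` and `J² ≠ 0` for the Jacobson
radical `J`. -/
theorem statement7 (𝕜 : Type) [Field 𝕜] [IsAlgClosed 𝕜] (m n : ℕ) (hm : 1 < m) (hn : 1 < n)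
    (ξ : 𝕜) (hξ : IsPrimitiveRoot ξ (m * n)) :
    (∀ i j : ℤ, (∀ k : ℕ, k ≤ n - 2 → (ξ ^ m) ^ (i + k) ≠ ξ ^ j) →
      ∀ (V : Type) [AddCommGroup V] [Module 𝕜 V] [Module (H 𝕜 m n ξ) V]
        [IsScalarTower 𝕜 (H 𝕜 m n ξ) V],
      IsZrep 𝕜 m n ξ i j V → Module.Projective (H 𝕜 m n ξ) V) ∧
    (∀ x ∈ jrad 𝕜 m n ξ, ∀ y ∈ jrad 𝕜 m n ξ, ∀ z ∈ jrad 𝕜 m n ξ, x * y * z = 0) ∧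
    (∃ x ∈ jrad 𝕜 m n ξ, ∃ y ∈ jrad 𝕜 m n ξ, x * y ≠ 0) := by
  have hξ0 : ξ ≠ 0 := hξ.ne_zero (by positivity)
  have hpow : ∀ j : ℤ, (ξ ^ j) ^ (m * n) = 1 := fun j => by
    rw [← zpow_natCast, zpow_comm, zpow_natCast, hξ.pow_eq_one, one_zpow]
  refine ⟨fun i j hij V _ _ _ _ hV => ?_, fun x hx y hy z hz => jrad_cube hm hn hξ hx hy hz,
    _, gen_a_pow_mul_specProj_mem_jrad hm hn hξ, _, gen_d_pow_mul_specProj_mem_jrad hm hn hξ,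
    gen_a_pow_mul_gen_d_pow_ne_zero hm hn hξ⟩
  obtain ⟨z, hdz, hbz, hcz, hli, hspan⟩ := hV
  refine projective_of_eigenvector hm hn hξ (hpow j) (hpow i) (fun k hk => ?_) hbz hcz hdz hli hspan
  have := hij k hk
  rwa [zpow_add₀ (pow_ne_zero _ hξ0), zpow_natCast, ← zpow_natCast ξ m, zpow_comm ξ,
    zpow_natCast ξ m, zpow_natCast (ξ ^ i) m, mul_comm] at this

end Radford
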